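/- arXiv:math/0403190 — 3 statements merged into one kernel-verified Lean document; each statement's English description precedes it below -/
import Mathlib

section
/- Let (Ω,T) be a minimal subshift over a finite alphabet 𝒜. Then the following are equivalent: (i) (Ω,T) satisfies Boshernitzan's condition (B); (ii) (Ω,T) satisfies condition (B'); (iii) (Ω,T) is uniquely ergodic and there exists a sequence (l'_n) in ℕ with l'_n → ∞ such that for every subadditive function F : 𝒲(Ω) → ℝ and every sequence (w_n) in 𝒲(Ω) with |w_n| = l'_n for every n, one has lim_{n→∞} F(w_n)/|w_n| = Λ(F). -/
open Filter MeasureTheory Set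

noncomputable section

/-- `SL(2,ℝ)`. -/
abbrev SL2 : Type := Matrix.SpecialLinearGroup (Fin 2) ℝ

/-- The left shift on two-sided sequences. -/
def shift (𝒜 : Type*) : (ℤ → 𝒜) → ℤ → 𝒜 := fun ω n => ω (n + 1)

/-- A subshift: a closed, shift-invariant set of two-sided sequences. -/
def IsSubshift {𝒜 : Type*} [TopologicalSpace 𝒜] (Ω : Set (ℤ → 𝒜)) : Prop :=
  IsClosed Ω ∧ shift 𝒜 '' Ω = Ω

/-- A minimal subshift: every two-sided orbit is dense. -/
def IsMinimalSubshift {𝒜 : Type*} [TopologicalSpace 𝒜] (Ω : Set (ℤ → 𝒜)) : Prop :=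
  IsSubshift Ω ∧ ∀ ω ∈ Ω, Ω ⊆ closure (Set.range fun k : ℤ => fun n : ℤ => ω (n + k))

/-- An aperiodic subshift: no nontrivial shift fixes a point of `Ω`. -/
def IsAperiodicSubshift {𝒜 : Type*} (Ω : Set (ℤ → 𝒜)) : Prop :=
  ∀ ω ∈ Ω, ∀ n : ℤ, n ≠ 0 → (fun m => ω (m + n)) ≠ ω

/-- The word `w` occurs in `ω` starting at position `k`. -/
def OccursAt {𝒜 : Type*} (ω : ℤ → 𝒜) (w : List 𝒜) (k : ℤ) : Prop :=
  ∀ i : Fin w.length, ω (k + i) = w.get i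

/-- `w` belongs to `𝒲(Ω)`, the set of finite words of the subshift `Ω`. -/
def IsWordOf {𝒜 : Type*} (Ω : Set (ℤ → 𝒜)) (w : List 𝒜) : Prop :=
  ∃ ω ∈ Ω, ∃ k : ℤ, OccursAt ω w k

/-- `V_w = {ω ∈ Ω : ω(1)⋯ω(|w|) = w}`. -/
def Vset {𝒜 : Type*} (Ω : Set (ℤ → 𝒜)) (w : List 𝒜) : Set (ℤ → 𝒜) :=
  {ω ∈ Ω | OccursAt ω w 1}

/-- `U_w = {ω ∈ Ω : w occurs in ω around position one}`. -/
def Uset {𝒜 : Type*} (Ω : Set (ℤ → 𝒜)) (w : List 𝒜) : Set (ℤ → 𝒜) :=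
  {ω ∈ Ω | ∃ n : ℕ, n < w.length ∧ OccursAt ω w (1 - n)}

/-- Boshernitzan's condition (B): there are an ergodic probability measure `ν` (concentrated
on `Ω`), a constant `C > 0` and lengths `l n → ∞` with `|w| ν(V_w) ≥ C` whenever `|w| = l n`;
equivalently `limsup n η_ν(n) > 0`. -/
def CondB {𝒜 : Type*} [MeasurableSpace 𝒜] (Ω : Set (ℤ → 𝒜)) : Prop :=
  ∃ ν : Measure (ℤ → 𝒜), IsProbabilityMeasure ν ∧ ν Ωᶜ = 0 ∧ Ergodic (shift 𝒜) ν ∧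
    ∃ C > (0 : ℝ), ∃ l : ℕ → ℕ, Tendsto l atTop atTop ∧
      ∀ n : ℕ, ∀ w : List 𝒜, IsWordOf Ω w → w.length = l n →
        C ≤ (w.length : ℝ) * (ν (Vset Ω w)).toReal

/-- Condition (B'): there are an ergodic probability measure `ν` (concentrated on `Ω`),
a constant `C' > 0` and lengths `l n → ∞` with `ν(U_w) ≥ C'` whenever `|w| = l n`. -/
def CondB' {𝒜 : Type*} [MeasurableSpace 𝒜] (Ω : Set (ℤ → 𝒜)) : Prop :=
  ∃ ν : Measure (ℤ → 𝒜), IsProbabilityMeasure ν ∧ ν Ωᶜ = 0 ∧ Ergodic (shift 𝒜) ν ∧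
    ∃ C > (0 : ℝ), ∃ l : ℕ → ℕ, Tendsto l atTop atTop ∧
      ∀ n : ℕ, ∀ w : List 𝒜, IsWordOf Ω w → w.length = l n →
        C ≤ (ν (Uset Ω w)).toReal

/-- Unique ergodicity: there is exactly one shift-invariant Borel probability measure
concentrated on `Ω`. -/
def UniquelyErgodicSubshift {𝒜 : Type*} [MeasurableSpace 𝒜] (Ω : Set (ℤ → 𝒜)) : Prop :=
  ∃! ν : Measure (ℤ → 𝒜),
    IsProbabilityMeasure ν ∧ ν Ωᶜ = 0 ∧ MeasurePreserving (shift 𝒜) ν ν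

/-- A function on sequences is locally constant (on `Ω`) if its value only depends on
the coordinates `ω(−N)⋯ω(N)` for some `N`. -/
def LocConstOn {𝒜 β : Type*} (Ω : Set (ℤ → 𝒜)) (A : (ℤ → 𝒜) → β) : Prop :=
  ∃ N : ℕ, ∀ ω ∈ Ω, ∀ ρ ∈ Ω, (∀ i : ℤ, |i| ≤ (N : ℤ) → ω i = ρ i) → A ω = A ρ

/-- The cocycle `A(n,ω) = A(T^{n−1}ω)⋯A(ω)`. -/
def cocycle {𝒜 G : Type*} [Monoid G] (A : (ℤ → 𝒜) → G) : ℕ → (ℤ → 𝒜) → G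
  | 0, _ => 1
  | n + 1, ω => A ((shift 𝒜)^[n] ω) * cocycle A n ω

/-- A concrete norm on 2×2 real matrices (the Frobenius norm). -/
def matNorm (M : Matrix (Fin 2) (Fin 2) ℝ) : ℝ :=
  Real.sqrt (∑ i : Fin 2, ∑ j : Fin 2, (M i j) ^ 2)

/-- `A : Ω → SL(2,ℝ)` is uniform: `(1/n) log‖A(n,ω)‖` converges, uniformly on `Ω`,
to a constant `Λ(A)`. -/
def IsUniformOn {𝒜 : Type*} (Ω : Set (ℤ → 𝒜)) (A : (ℤ → 𝒜) → SL2) : Prop :=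
  ∃ Λ : ℝ, TendstoUniformlyOn
    (fun (n : ℕ) (ω : ℤ → 𝒜) =>
      (n : ℝ)⁻¹ * Real.log (matNorm ((cocycle A n ω : SL2) : Matrix (Fin 2) (Fin 2) ℝ)))
    (fun _ => Λ) atTop Ω

/-- Property (P): every locally constant `SL(2,ℝ)`-valued function on `Ω` is uniform. -/
def PropP {𝒜 : Type*} (Ω : Set (ℤ → 𝒜)) : Prop :=
  ∀ A : (ℤ → 𝒜) → SL2, LocConstOn Ω A → IsUniformOn Ω A

/-- The word `ω(1)⋯ω(n)`. -/
def wordOf {𝒜 : Type*} (ω : ℤ → 𝒜) (n : ℕ) : List 𝒜 :=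
  (List.range n).map fun i => ω (1 + i)

/-- A subadditive function on the words of `Ω`. -/
def SubadditiveOn {𝒜 : Type*} (Ω : Set (ℤ → 𝒜)) (F : List 𝒜 → ℝ) : Prop :=
  ∀ x y : List 𝒜, IsWordOf Ω x → IsWordOf Ω y → IsWordOf Ω (x ++ y) →
    F (x ++ y) ≤ F x + F y

/-- The complexity function `p(n) = #{w ∈ 𝒲(Ω) : |w| = n}`. -/
def complexity {𝒜 : Type*} (Ω : Set (ℤ → 𝒜)) (n : ℕ) : ℕ :=
  Set.ncard {w : List 𝒜 | IsWordOf Ω w ∧ w.length = n}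

/-- A right-special word. -/
def RightSpecial {𝒜 : Type*} (Ω : Set (ℤ → 𝒜)) (w : List 𝒜) : Prop :=
  ∃ a b : 𝒜, a ≠ b ∧ IsWordOf Ω (w ++ [a]) ∧ IsWordOf Ω (w ++ [b])

/-- A left-special word. -/
def LeftSpecial {𝒜 : Type*} (Ω : Set (ℤ → 𝒜)) (w : List 𝒜) : Prop :=
  ∃ a b : 𝒜, a ≠ b ∧ IsWordOf Ω (a :: w) ∧ IsWordOf Ω (b :: w)

/-- `σ ∈ ℬ^ℤ` is the image of `ω ∈ 𝒜^ℤ` under the substitution `S`, with `S(ω(0))`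
starting at position `0`. -/
def IsSubstImage {𝒜 ℬ : Type*} (S : 𝒜 → List ℬ) (ω : ℤ → 𝒜) (σ : ℤ → ℬ) : Prop :=
  ∃ c : ℤ → ℤ, c 0 = 0 ∧ (∀ k : ℤ, c (k + 1) = c k + (S (ω k)).length) ∧
    ∀ k : ℤ, ∀ j : Fin (S (ω k)).length, σ (c k + j) = (S (ω k)).get j

/-- `Ω(S) = {T^k S(ω) : ω ∈ Ω, k ∈ ℤ}`. -/
def SubstSubshift {𝒜 ℬ : Type*} (S : 𝒜 → List ℬ) (Ω : Set (ℤ → 𝒜)) : Set (ℤ → ℬ) :=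
  {τ | ∃ ω ∈ Ω, ∃ σ : ℤ → ℬ, IsSubstImage S ω σ ∧ ∃ k : ℤ, τ = fun n => σ (n + k)}

/-- `S` is recognizable with respect to `(Ω,T)`: there is a locally constant
`S̃ : Ω(S) → Ω × ℤ` with `S̃(T^k S(ω)) = (ω,k)` for `0 ≤ k ≤ |S(ω(0))|`. -/
def Recognizable {𝒜 ℬ : Type*} (S : 𝒜 → List ℬ) (Ω : Set (ℤ → 𝒜)) : Prop :=
  ∃ St : (ℤ → ℬ) → (ℤ → 𝒜) × ℤ, LocConstOn (SubstSubshift S Ω) St ∧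
    ∀ ω ∈ Ω, ∀ σ : ℤ → ℬ, IsSubstImage S ω σ →
      ∀ k : ℕ, k ≤ (S (ω 0)).length → St (fun n => σ (n + k)) = (ω, (k : ℤ))

/-- A Cantor set: compact, empty interior, no isolated points. -/
def IsCantorSet (S : Set ℝ) : Prop :=
  IsCompact S ∧ interior S = ∅ ∧ ∀ x ∈ S, AccPt x (Filter.principal S)

/-- `H` is the Schrödinger operator on `ℓ²(ℤ)` with potential `V`:
`(Hu)(n) = u(n+1) + u(n−1) + V(n)u(n)`. -/
def IsSchrodingerOp (V : ℤ → ℝ)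
    (H : lp (fun _ : ℤ => ℝ) 2 →L[ℝ] lp (fun _ : ℤ => ℝ) 2) : Prop :=
  ∀ u : lp (fun _ : ℤ => ℝ) 2, ∀ n : ℤ,
    (H u : ∀ _ : ℤ, ℝ) n = (u : ∀ _ : ℤ, ℝ) (n + 1) + (u : ∀ _ : ℤ, ℝ) (n - 1)
      + V n * (u : ∀ _ : ℤ, ℝ) n

/-- The circle map potential `V_{α,β,θ}(n) = χ_{[1−β,1)}(nα + θ mod 1)`. -/
def circleV (α β θ : ℝ) : ℤ → ℝ := fun n =>
  (Set.Ico (1 - β) 1).indicator (fun _ => (1 : ℝ)) (Int.fract (n * α + θ))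

/-- The coding `v_n(α,β,θ) = χ_{[0,β)}(nα + θ mod 1)` of the rotation by `α`. -/
def circleSeq (α β θ : ℝ) : ℤ → Bool := fun n =>
  if Int.fract (n * α + θ) < β then true else false

/-- The circle map subshift `Ω_{α,β}`. -/
def circleSubshift (α β : ℝ) : Set (ℤ → Bool) :=
  closure {ω | ∃ θ : ℝ, 0 ≤ θ ∧ θ < 1 ∧ ω = circleSeq α β θ}

/-- The one-step transfer matrix `M^E(ω)`. -/
def transferMat (E : ℝ) (ω : ℤ → ℝ) : Matrix (Fin 2) (Fin 2) ℝ :=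
  !![E - ω 1, -1; 1, 0]

/-- The Lyapunov exponent `γ(E) = inf_{n ≥ 1} (1/n) ∫ log‖M^E(n,ω)‖ dμ(ω)`. -/
def lyapunov (μ : Measure (ℤ → ℝ)) (E : ℝ) : ℝ :=
  ⨅ n : ℕ+, ((n : ℕ) : ℝ)⁻¹ *
    ∫ ω, Real.log (matNorm (cocycle (transferMat E) (n : ℕ) ω)) ∂μ

end

section Words

variable {𝒜 : Type*}

/-- The translate of a two-sided sequence by the integer `k`. -/
def ztranslate (k : ℤ) (ω : ℤ → 𝒜) : ℤ → 𝒜 := fun n => ω (n + k)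

theorem ztranslate_apply (k : ℤ) (ω : ℤ → 𝒜) (n : ℤ) : ztranslate k ω n = ω (n + k) := rfl

@[simp] theorem ztranslate_zero (ω : ℤ → 𝒜) : ztranslate 0 ω = ω := by
  funext n; simp [ztranslate]

theorem ztranslate_ztranslate (j k : ℤ) (ω : ℤ → 𝒜) :
    ztranslate j (ztranslate k ω) = ztranslate (k + j) ω := by
  funext n; simp [ztranslate, add_comm, add_left_comm]

theorem shift_eq_ztranslate (ω : ℤ → 𝒜) : shift 𝒜 ω = ztranslate 1 ω := rfl

theorem shift_iterate (j : ℕ) : (shift 𝒜)^[j] = ztranslate (j : ℤ) := by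
  induction j with
  | zero => funext ω; simp
  | succ j ih =>
    funext ω
    rw [Function.iterate_succ_apply', ih, shift_eq_ztranslate, ztranslate_ztranslate]
    push_cast; rfl

theorem wordOf_eq_map (ω : ℤ → 𝒜) (n : ℕ) :
    wordOf ω n = (List.range n).map fun i : ℕ => ω (1 + (i : ℤ)) := by
  simp [wordOf, List.map_eq_flatMap, List.flatMap_assoc]

@[simp] theorem length_wordOf (ω : ℤ → 𝒜) (n : ℕ) : (wordOf ω n).length = n := by
  simp [wordOf_eq_map]

theorem wordOf_add (ω : ℤ → 𝒜) (a b : ℕ) :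
    wordOf ω (a + b) = wordOf ω a ++ wordOf (ztranslate a ω) b := by
  simp only [wordOf_eq_map, List.range_add, List.map_append, List.map_map]
  congr 1
  apply List.map_congr_left
  intro i _
  simp only [Function.comp, ztranslate]
  congr 1; push_cast; ring

theorem wordOf_eq_iff (ω : ℤ → 𝒜) (w : List 𝒜) :
    wordOf ω w.length = w ↔ ∀ i : Fin w.length, ω (1 + i) = w.get i := by
  constructor
  · intro h i
    have h2 : (wordOf ω w.length)[(i : ℕ)]'(by simp) = w[(i : ℕ)] := by simp [h]
    simpa [wordOf_eq_map] using h2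
  · intro h
    apply List.ext_get (by simp)
    intro n h1 h2
    have := h ⟨n, h2⟩
    simpa [wordOf_eq_map] using this

theorem occursAt_iff (ω : ℤ → 𝒜) (w : List 𝒜) (k : ℤ) :
    OccursAt ω w k ↔ wordOf (ztranslate (k - 1) ω) w.length = w := by
  rw [wordOf_eq_iff, OccursAt]
  refine forall_congr' fun i => ?_
  rw [ztranslate_apply]
  have : (1 + (i : ℤ) + (k - 1)) = k + i := by ring
  rw [this]

/-- Equal long words have equal subwords. -/
theorem wordOf_ztranslate_congr {ω ρ : ℤ → 𝒜} {l : ℕ} (h : wordOf ω l = wordOf ρ l)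
    {k m : ℕ} (hkm : k + m ≤ l) :
    wordOf (ztranslate k ω) m = wordOf (ztranslate k ρ) m := by
  obtain ⟨s, rfl⟩ := Nat.exists_eq_add_of_le hkm
  rw [wordOf_add, wordOf_add ρ, wordOf_add, wordOf_add ρ] at h
  exact List.append_inj_right (List.append_inj_left h (by simp)) (by simp)

theorem isWordOf_wordOf {Ω : Set (ℤ → 𝒜)} {ω : ℤ → 𝒜} (hω : ω ∈ Ω) (n : ℕ) :
    IsWordOf Ω (wordOf ω n) := by
  refine ⟨ω, hω, 1, ?_⟩
  rw [occursAt_iff]; simp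

theorem exists_bound_wordOf [Fintype 𝒜] (n : ℕ) (f : List 𝒜 → ℝ) :
    ∃ D : ℝ, 0 ≤ D ∧ ∀ ω : ℤ → 𝒜, |f (wordOf ω n)| ≤ D := by
  obtain ⟨D, hD⟩ := ((List.finite_length_eq 𝒜 n).image fun w => |f w|).bddAbove
  refine ⟨max D 0, le_max_right _ _, fun ω => le_trans (hD ⟨_, ?_, rfl⟩) (le_max_left _ _)⟩
  simp

end Words

section Subshift

variable {𝒜 : Type*} [TopologicalSpace 𝒜] {Ω : Set (ℤ → 𝒜)}

theorem IsSubshift.translate_mem (h : IsSubshift Ω) {ω : ℤ → 𝒜} (hω : ω ∈ Ω) (k : ℤ) :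
    ztranslate k ω ∈ Ω := by
  have hs : ∀ ρ ∈ Ω, ztranslate 1 ρ ∈ Ω := fun ρ hρ => by
    rw [← h.2]; exact ⟨ρ, hρ, rfl⟩
  have hp : ∀ ρ ∈ Ω, ztranslate (-1) ρ ∈ Ω := fun ρ hρ => by
    have h1 := hρ
    rw [← h.2] at h1
    obtain ⟨τ, hτ, rfl⟩ := h1
    rw [shift_eq_ztranslate, ztranslate_ztranslate]
    simpa using hτ
  induction k using Int.induction_on with
  | zero => simpa
  | succ i ih => have := hs _ ih; rwa [ztranslate_ztranslate] at this
  | pred i ih =>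
    have := hp _ ih
    rwa [ztranslate_ztranslate] at this

theorem IsSubshift.exists_wordOf_eq (h : IsSubshift Ω) {w : List 𝒜} (hw : IsWordOf Ω w) :
    ∃ ω ∈ Ω, wordOf ω w.length = w := by
  obtain ⟨ω, hω, k, hk⟩ := hw
  exact ⟨ztranslate (k - 1) ω, h.translate_mem hω _, (occursAt_iff _ _ _).1 hk⟩

theorem IsMinimalSubshift.exists_translate [DiscreteTopology 𝒜] (h : IsMinimalSubshift Ω)
    {ω : ℤ → 𝒜} (hω : ω ∈ Ω) {w : List 𝒜} (hw : IsWordOf Ω w) :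
    ∃ k : ℤ, wordOf (ztranslate k ω) w.length = w := by
  obtain ⟨ρ, hρ, hρw⟩ := h.1.exists_wordOf_eq hw
  have hopen : IsOpen {τ : ℤ → 𝒜 | ∀ i : Fin w.length, τ (1 + i) = w.get i} := by
    rw [show {τ : ℤ → 𝒜 | ∀ i : Fin w.length, τ (1 + i) = w.get i}
      = ⋂ i : Fin w.length, (fun τ : ℤ → 𝒜 => τ (1 + i)) ⁻¹' {w.get i} by ext; simp]
    exact isOpen_iInter_of_finite fun i => (isOpen_discrete _).preimage (continuous_apply _)
  obtain ⟨τ, hτ, k, rfl⟩ := mem_closure_iff.1 (h.2 ω hω hρ) _ hopen ((wordOf_eq_iff _ _).1 hρw)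
  exact ⟨k, (wordOf_eq_iff _ _).2 hτ⟩

end Subshift

section Invariance

variable {𝒜 : Type*} [MeasurableSpace 𝒜] {ν : Measure (ℤ → 𝒜)}

theorem measure_preimage_ztranslate (hinv : MeasurePreserving (shift 𝒜) ν ν)
    {s : Set (ℤ → 𝒜)} (hs : NullMeasurableSet s ν) (k : ℕ) :
    ν (ztranslate (k : ℤ) ⁻¹' s) = ν s := by
  rw [← shift_iterate]
  exact (hinv.iterate k).measure_preimage hs

theorem integral_comp_ztranslate (hinv : MeasurePreserving (shift 𝒜) ν ν)
    {f : (ℤ → 𝒜) → ℝ} (hf : AEMeasurable f ν) (k : ℕ) :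
    ∫ ω, f (ztranslate (k : ℤ) ω) ∂ν = ∫ ω, f ω ∂ν := by
  have h := hinv.iterate k
  rw [shift_iterate] at h
  conv_rhs => rw [← h.map_eq]
  rw [integral_map h.aemeasurable]
  rw [h.map_eq]; exact hf.aestronglyMeasurable

end Invariance

section Measurability

variable {𝒜 : Type*} [Fintype 𝒜] [TopologicalSpace 𝒜] [DiscreteTopology 𝒜]
  [MeasurableSpace 𝒜] {Ω : Set (ℤ → 𝒜)} {ν : Measure (ℤ → 𝒜)}

theorem preimage_comp_eq_of_measurableSet {α ι : Type*} [MeasurableSpace α] {g : α → α}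
    (hg : ∀ s : Set α, MeasurableSet s → g ⁻¹' s = s) {N : Set (ι → α)} (hN : MeasurableSet N) :
    (fun ω : ι → α => g ∘ ω) ⁻¹' N = N := by
  let M : MeasurableSpace (ι → α) :=
    { MeasurableSet' := fun S => (fun ω : ι → α => g ∘ ω) ⁻¹' S = S
      measurableSet_empty := rfl
      measurableSet_compl := fun s hs => by rw [preimage_compl, hs]
      measurableSet_iUnion := fun f hf => by rw [preimage_iUnion]; simp_rw [hf] }
  have hle : (MeasurableSpace.pi : MeasurableSpace (ι → α)) ≤ M := by
    refine iSup_le fun i => ?_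
    rintro _ ⟨s, hs, rfl⟩
    change (fun ω : ι → α => g ∘ ω) ⁻¹' _ = _
    rw [← preimage_comp]
    exact congrArg (fun t : Set α => (fun ω : ι → α => ω i) ⁻¹' t) (hg s hs)
  exact hle N hN

/-- A letter of a minimal subshift carrying a probability measure is measurable. -/
theorem IsMinimalSubshift.measurableSet_singleton (h : IsMinimalSubshift Ω)
    [IsProbabilityMeasure ν] (hν : ν Ωᶜ = 0) {a : 𝒜} (ha : IsWordOf Ω [a]) :
    MeasurableSet ({a} : Set 𝒜) := by
  classical
  by_contra hna
  have hat : MeasurableSet (measurableAtom a) := MeasurableSet.measurableAtom_of_countable a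
  obtain ⟨b, hb, hba⟩ : ∃ b ∈ measurableAtom a, b ≠ a := by
    by_contra! hcon
    apply hna
    rwa [show ({a} : Set 𝒜) = measurableAtom a from
      Subset.antisymm (by simp) (fun b hb => hcon b hb)]
  have hiff : ∀ s : Set 𝒜, MeasurableSet s → (b ∈ s ↔ a ∈ s) := fun s hs => by
    refine ⟨fun h1 => ?_, mem_of_mem_measurableAtom hb hs⟩
    by_contra h2
    exact mem_of_mem_measurableAtom hb hs.compl h2 h1
  obtain ⟨ω, hω⟩ : ((toMeasurable ν Ωᶜ)ᶜ).Nonempty := by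
    apply nonempty_of_measure_ne_zero (μ := ν)
    rw [prob_compl_eq_one_sub (measurableSet_toMeasurable _ _), measure_toMeasurable, hν]
    simp
  let g : 𝒜 → 𝒜 := fun x => if x = a then b else x
  have hg : ∀ s : Set 𝒜, MeasurableSet s → g ⁻¹' s = s := fun s hs => by
    ext x
    by_cases hx : x = a
    · simp [g, hx, hiff s hs]
    · simp [g, hx]
  have hgω : g ∘ ω ∈ Ω := by
    by_contra hcon
    have h1 : g ∘ ω ∈ toMeasurable ν Ωᶜ := subset_toMeasurable _ _ hcon
    have h2 := preimage_comp_eq_of_measurableSet hg (ι := ℤ) (measurableSet_toMeasurable ν Ωᶜ)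
    rw [← h2] at hω
    exact hω h1
  obtain ⟨k, hk⟩ := h.exists_translate hgω ha
  have h3 := (wordOf_eq_iff _ _).1 hk ⟨0, by simp⟩
  simp only [ztranslate, Function.comp, g, List.get] at h3
  split_ifs at h3 with h4
  · exact hba h3
  · exact h4 h3

theorem IsMinimalSubshift.measurableSet_wordOf_eq (h : IsMinimalSubshift Ω)
    [IsProbabilityMeasure ν] (hν : ν Ωᶜ = 0) {w : List 𝒜} (hw : IsWordOf Ω w) (k : ℤ) :
    MeasurableSet {ω : ℤ → 𝒜 | wordOf (ztranslate k ω) w.length = w} := by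
  simp_rw [wordOf_eq_iff, ztranslate_apply]
  rw [show {ω : ℤ → 𝒜 | ∀ i : Fin w.length, ω (1 + i + k) = w.get i}
    = ⋂ i : Fin w.length, (fun ω : ℤ → 𝒜 => ω (1 + i + k)) ⁻¹' {w.get i} by ext; simp]
  refine MeasurableSet.iInter fun i => ?_
  refine measurable_pi_apply _ (h.measurableSet_singleton hν ?_)
  obtain ⟨ρ, hρ, j, hj⟩ := hw
  exact ⟨ρ, hρ, j + i, fun ⟨n, hn⟩ => by
    have : n = 0 := by simpa using hn
    subst this
    simpa using hj i⟩

theorem IsMinimalSubshift.nullMeasurableSet_wordOf (h : IsMinimalSubshift Ω)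
    [IsProbabilityMeasure ν] (hν : ν Ωᶜ = 0) (k : ℤ) (n : ℕ) (S : Set (List 𝒜)) :
    NullMeasurableSet {ω : ℤ → 𝒜 | wordOf (ztranslate k ω) n ∈ S} ν := by
  have hm : MeasurableSet (⋃ w ∈ {w | w ∈ S ∧ IsWordOf Ω w ∧ w.length = n},
      {ω : ℤ → 𝒜 | wordOf (ztranslate k ω) w.length = w}) :=
    MeasurableSet.biUnion (Set.to_countable _)
      fun w (hw : w ∈ S ∧ IsWordOf Ω w ∧ w.length = n) => h.measurableSet_wordOf_eq hν hw.2.1 k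
  refine hm.nullMeasurableSet.congr (Filter.eventuallyEq_set.2 ?_)
  filter_upwards [show ∀ᵐ ω ∂ν, ω ∈ Ω from hν] with ω hω
  simp only [mem_iUnion, mem_ofPred_eq]
  constructor
  · rintro ⟨w, ⟨h1, h2, rfl⟩, h3⟩
    rwa [h3]
  · intro h1
    exact ⟨_, ⟨h1, isWordOf_wordOf (h.1.translate_mem hω k) n, by simp⟩, by simp⟩

theorem IsMinimalSubshift.aemeasurable_wordOf (h : IsMinimalSubshift Ω)
    [IsProbabilityMeasure ν] (hν : ν Ωᶜ = 0) (k : ℤ) (n : ℕ) (f : List 𝒜 → ℝ) :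
    AEMeasurable (fun ω : ℤ → 𝒜 => f (wordOf (ztranslate k ω) n)) ν := by
  refine NullMeasurable.aemeasurable fun s _ => ?_
  exact h.nullMeasurableSet_wordOf hν k n (f ⁻¹' s)

theorem IsMinimalSubshift.integrable_wordOf (h : IsMinimalSubshift Ω)
    [IsProbabilityMeasure ν] (hν : ν Ωᶜ = 0) (k : ℤ) (n : ℕ) (f : List 𝒜 → ℝ) :
    Integrable (fun ω : ℤ → 𝒜 => f (wordOf (ztranslate k ω) n)) ν := by
  obtain ⟨D, -, hD⟩ := exists_bound_wordOf n f
  exact Integrable.of_bound (h.aemeasurable_wordOf hν k n f).aestronglyMeasurable D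
    (ae_of_all _ fun ω => hD _)

end Measurability

section Occurrence

variable {𝒜 : Type*} [Fintype 𝒜] [TopologicalSpace 𝒜] [DiscreteTopology 𝒜]
  [MeasurableSpace 𝒜] {Ω : Set (ℤ → 𝒜)} {ν : Measure (ℤ → 𝒜)}

theorem measure_Vset {𝒜 : Type*} [MeasurableSpace 𝒜] {Ω : Set (ℤ → 𝒜)} {ν : Measure (ℤ → 𝒜)}
    (hν : ν Ωᶜ = 0) (w : List 𝒜) :
    ν (Vset Ω w) = ν {ω | wordOf ω w.length = w} := by
  rw [← measure_inter_conull (s := {ω | wordOf ω w.length = w}) hν]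
  congr 1
  ext ω
  simp [Vset, occursAt_iff, and_comm]

theorem IsMinimalSubshift.nullMeasurableSet_occurs (h : IsMinimalSubshift Ω)
    [IsProbabilityMeasure ν] (hν : ν Ωᶜ = 0) (w : List 𝒜) (a b : ℕ) (k : ℤ) (n : ℕ) :
    NullMeasurableSet {ω : ℤ → 𝒜 | ∃ j, a ≤ j ∧ j < b ∧ wordOf (ztranslate (k + j) ω) n = w} ν := by
  have : {ω : ℤ → 𝒜 | ∃ j, a ≤ j ∧ j < b ∧ wordOf (ztranslate (k + j) ω) n = w}
      = ⋃ j ∈ Finset.Ico a b, {ω : ℤ → 𝒜 | wordOf (ztranslate (k + (j : ℕ)) ω) n ∈ ({w} : Set _)} := by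
    ext ω; simp [and_assoc]
  rw [this]
  exact Finset.nullMeasurableSet_biUnion _ fun j _ => h.nullMeasurableSet_wordOf hν _ n {w}

/-- The measure of `Uset Ω w` is the measure of the set of sequences in which `w` starts at one of
`|w|` consecutive positions. -/
theorem IsMinimalSubshift.measure_Uset (h : IsMinimalSubshift Ω)
    [IsProbabilityMeasure ν] (hν : ν Ωᶜ = 0) (hinv : MeasurePreserving (shift 𝒜) ν ν)
    (w : List 𝒜) (a : ℕ) :
    ν (Uset Ω w) = ν {ω : ℤ → 𝒜 | ∃ j, a ≤ j ∧ j < a + w.length ∧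
      wordOf (ztranslate (j : ℤ) ω) w.length = w} := by
  rcases Nat.eq_zero_or_pos w.length with h0 | hpos
  · have h1 : Uset Ω w = ∅ := by ext; simp [Uset, h0]
    have h2 : {ω : ℤ → 𝒜 | ∃ j, a ≤ j ∧ j < a + w.length ∧
        wordOf (ztranslate (j : ℤ) ω) w.length = w} = ∅ := by
      ext ω
      simp only [mem_ofPred_eq, mem_empty_iff_false, iff_false, not_exists]
      intro j hj; omega
    rw [h1, h2]
  have hU : ν (Uset Ω w) = ν {ω : ℤ → 𝒜 | ∃ j, 0 ≤ j ∧ j < w.length ∧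
      wordOf (ztranslate (1 - (w.length : ℤ) + (j : ℕ)) ω) w.length = w} := by
    rw [← measure_inter_conull (s := {ω : ℤ → 𝒜 | ∃ j, 0 ≤ j ∧ j < w.length ∧
      wordOf (ztranslate (1 - (w.length : ℤ) + (j : ℕ)) ω) w.length = w}) hν]
    congr 1
    ext ω
    simp only [Uset, mem_ofPred_eq, mem_inter_iff, occursAt_iff]
    rw [and_comm]
    refine and_congr_left fun _ => ⟨?_, ?_⟩
    · rintro ⟨n, hn, hw⟩
      refine ⟨w.length - 1 - n, by omega, by omega, ?_⟩
      rw [show (1 - (w.length : ℤ) + ((w.length - 1 - n : ℕ) : ℤ)) = 1 - (n : ℤ) - 1 by omega]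
      exact hw
    · rintro ⟨n, -, hn, hw⟩
      refine ⟨w.length - 1 - n, by omega, ?_⟩
      rw [show 1 - ((w.length - 1 - n : ℕ) : ℤ) - 1 = (1 - (w.length : ℤ) + (n : ℤ)) by omega]
      exact hw
  rw [hU, ← measure_preimage_ztranslate hinv
    (h.nullMeasurableSet_occurs hν w 0 w.length _ _) (w.length - 1 + a)]
  congr 1
  ext ω
  simp only [mem_preimage, mem_ofPred_eq, ztranslate_ztranslate]
  constructor
  · rintro ⟨j, -, hj, hw⟩
    refine ⟨a + j, by omega, by omega, ?_⟩
    rw [show ((a + j : ℕ) : ℤ) = ((w.length - 1 + a : ℕ) : ℤ) + (1 - (w.length : ℤ) + (j : ℤ)) by omega]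
    exact hw
  · rintro ⟨j, h1, hj, hw⟩
    refine ⟨j - a, by omega, by omega, ?_⟩
    rw [show ((w.length - 1 + a : ℕ) : ℤ) + (1 - (w.length : ℤ) + ((j - a : ℕ) : ℤ)) = j by omega]
    exact hw

theorem IsMinimalSubshift.measure_Uset_le (h : IsMinimalSubshift Ω)
    [IsProbabilityMeasure ν] (hν : ν Ωᶜ = 0) (hinv : MeasurePreserving (shift 𝒜) ν ν)
    (w : List 𝒜) :
    (ν (Uset Ω w)).toReal ≤ w.length * (ν (Vset Ω w)).toReal := by
  rw [h.measure_Uset hν hinv w 0, measure_Vset hν]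
  have h1 : ν {ω : ℤ → 𝒜 | ∃ j, 0 ≤ j ∧ j < 0 + w.length ∧
      wordOf (ztranslate (j : ℤ) ω) w.length = w} ≤
      w.length * ν {ω | wordOf ω w.length = w} := by
    calc _ ≤ ν (⋃ j ∈ Finset.range w.length, ztranslate ((j : ℕ) : ℤ) ⁻¹'
            {ω : ℤ → 𝒜 | wordOf ω w.length = w}) := by
          refine measure_mono ?_
          rintro ω ⟨j, -, hj, hw⟩
          simp only [mem_iUnion]
          exact ⟨j, by simpa using hj, hw⟩
      _ ≤ ∑ j ∈ Finset.range w.length, ν (ztranslate ((j : ℕ) : ℤ) ⁻¹'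
            {ω : ℤ → 𝒜 | wordOf ω w.length = w}) := measure_biUnion_finset_le _ _
      _ = ∑ j ∈ Finset.range w.length, ν {ω : ℤ → 𝒜 | wordOf ω w.length = w} := by
          refine Finset.sum_congr rfl fun j _ => measure_preimage_ztranslate hinv ?_ j
          simpa using h.nullMeasurableSet_wordOf hν 0 w.length {w}
      _ = _ := by simp
  have h2 := ENNReal.toReal_mono (by finiteness) h1
  simpa using h2

theorem IsMinimalSubshift.card_mul_le_measureReal (h : IsMinimalSubshift Ω)
    [IsProbabilityMeasure ν] (hν : ν Ωᶜ = 0) {K l : ℕ} {x : ℕ → List 𝒜} {c : ℝ}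
    (hinj : ∀ i < K, ∀ j < K, x i = x j → i = j)
    (hc : ∀ j < K, c ≤ ν.real {ω | wordOf ω l = x j}) {A : Set (ℤ → 𝒜)}
    (hA : ∀ j < K, ∀ ω, wordOf ω l = x j → ω ∈ A) :
    K * c ≤ ν.real A := by
  calc K * c = ∑ j ∈ Finset.range K, c := by simp
    _ ≤ ∑ j ∈ Finset.range K, ν.real {ω | wordOf ω l = x j} :=
        Finset.sum_le_sum fun j hj => hc j (Finset.mem_range.1 hj)
    _ = ν.real (⋃ j ∈ Finset.range K, {ω | wordOf ω l = x j}) := by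
        simp only [measureReal_def]
        rw [measure_biUnion_finset₀, ENNReal.toReal_sum (fun _ _ => by finiteness)]
        · intro i hi j hj hij
          refine Disjoint.aedisjoint (Set.disjoint_left.2 fun ω h1 h2 => hij ?_)
          simp only [Finset.coe_range, mem_Iio] at hi hj
          exact hinj i hi j hj (h1.symm.trans h2)
        · intro j _
          simpa using h.nullMeasurableSet_wordOf hν 0 l {x j}
    _ ≤ ν.real A := by
        refine measureReal_mono ?_ 
        intro ω hω
        simp only [mem_iUnion] at hω
        obtain ⟨j, hj, hω⟩ := hω
        exact hA j (Finset.mem_range.1 hj) ω hω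

theorem exists_isolated_occurrence {p : ℤ → Prop} {r : ℕ} (hex : ∃ k, p k)
    (hgap : ∀ j : ℕ, j ≤ r → ¬ p j) :
    ∃ k, p k ∧ ((∀ d : ℕ, 1 ≤ d → d ≤ r → ¬ p (k - d)) ∨ (∀ d : ℕ, 1 ≤ d → d ≤ r → ¬ p (k + d))) := by
  classical
  obtain ⟨k, hk⟩ := hex
  rcases lt_or_ge k 0 with h0 | h0
  · have hex : ∃ i : ℕ, p (-1 - i) := ⟨(-1 - k).toNat, by
      rwa [show (-1 - ((-1 - k).toNat : ℤ)) = k by omega]⟩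
    refine ⟨_, Nat.find_spec hex, Or.inr fun d h1 h2 hp => ?_⟩
    by_cases hd : d ≤ Nat.find hex
    · refine Nat.find_min hex (m := Nat.find hex - d) (by omega) ?_
      rwa [show (-1 - ((Nat.find hex - d : ℕ) : ℤ)) = -1 - (Nat.find hex : ℤ) + d by omega]
    · refine hgap (d - 1 - Nat.find hex) (by omega) ?_
      rwa [show ((d - 1 - Nat.find hex : ℕ) : ℤ) = -1 - (Nat.find hex : ℤ) + d by omega]
  · have hex : ∃ i : ℕ, p i := ⟨k.toNat, by rwa [show ((k.toNat : ℕ) : ℤ) = k by omega]⟩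
    refine ⟨_, Nat.find_spec hex, Or.inl fun d h1 h2 hp => ?_⟩
    by_cases hd : d ≤ Nat.find hex
    · refine Nat.find_min hex (m := Nat.find hex - d) (by omega) ?_
      rwa [show (((Nat.find hex - d : ℕ) : ℤ)) = (Nat.find hex : ℤ) - d by omega]
    · have : r < Nat.find hex := by
        by_contra hcon
        exact hgap _ (not_lt.1 hcon) (Nat.find_spec hex)
      omega

/-- If all words of length `l` have measure at least `C / l`, then the words of length `l / 2 + 1`
occur around the origin with probability bounded below. -/
theorem IsMinimalSubshift.le_measure_Uset (h : IsMinimalSubshift Ω)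
    [IsProbabilityMeasure ν] (hν : ν Ωᶜ = 0) (hinv : MeasurePreserving (shift 𝒜) ν ν)
    {C : ℝ} (hC : 0 < C) {l : ℕ} (hl : 1 ≤ l)
    (hB : ∀ w : List 𝒜, IsWordOf Ω w → w.length = l → C ≤ l * ν.real {ω | wordOf ω l = w})
    {w : List 𝒜} (hw : IsWordOf Ω w) (hwl : w.length = l / 2 + 1) :
    min (C / 2) 1 ≤ (ν (Uset Ω w)).toReal := by
  rw [h.measure_Uset hν hinv w 0]
  have hlR : (0 : ℝ) < l := by exact_mod_cast hl
  set m := w.length with hm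
  by_cases hall : ∀ ω ∈ Ω, ∃ j : ℕ, j ≤ l - m ∧ wordOf (ztranslate (j : ℤ) ω) m = w
  · refine (min_le_right _ _).trans (le_of_eq ?_)
    have : ν {ω : ℤ → 𝒜 | ∃ j, 0 ≤ j ∧ j < 0 + m ∧ wordOf (ztranslate (j : ℤ) ω) m = w} = 1 := by
      refine (measure_congr (eventuallyEq_univ.2 ?_)).trans measure_univ
      filter_upwards [show ∀ᵐ ω ∂ν, ω ∈ Ω from hν] with ω hω
      obtain ⟨j, hj, hjw⟩ := hall ω hω
      exact ⟨j, by omega, by omega, hjw⟩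
    rw [this]; simp
  · push Not at hall
    obtain ⟨σ, hσ, hgap⟩ := hall
    obtain ⟨k, hk, hiso⟩ := exists_isolated_occurrence
      (p := fun k => wordOf (ztranslate k σ) m = w) (h.exists_translate hσ hw) hgap
    have key := h.card_mul_le_measureReal hν (K := l - m + 1) (l := l) (c := C / l)
      (x := fun t => wordOf (ztranslate (k - t) σ) l)
      (A := {ω : ℤ → 𝒜 | ∃ j, 0 ≤ j ∧ j < 0 + m ∧ wordOf (ztranslate (j : ℤ) ω) m = w}) ?_ ?_ ?_
    · refine (min_le_left _ _).trans (le_trans ?_ key)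
      rw [← mul_div_assoc, le_div_iff₀ hlR, div_mul_eq_mul_div, div_le_iff₀ two_pos]
      have : (l : ℝ) ≤ ((l - m + 1 : ℕ) : ℝ) * 2 := by
        have : l ≤ (l - m + 1) * 2 := by omega
        exact_mod_cast this
      nlinarith
    · have hlt : ∀ s t : ℕ, s < t → t < l - m + 1 →
          wordOf (ztranslate (k - s) σ) l ≠ wordOf (ztranslate (k - t) σ) l := by
        intro s t hst ht heq
        have h1 := wordOf_ztranslate_congr heq (k := t) (m := m) (by omega)
        have h2 := wordOf_ztranslate_congr heq (k := s) (m := m) (by omega)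
        simp only [ztranslate_ztranslate, sub_add_cancel] at h1 h2
        rw [hk] at h1 h2
        rcases hiso with hiso | hiso
        · apply hiso (t - s) (by omega) (by omega)
          rw [h2]; congr 2; omega
        · apply hiso (t - s) (by omega) (by omega)
          rw [← h1]; congr 2; omega
      intro i hi j hj hij
      rcases lt_trichotomy i j with h1 | h1 | h1
      · exact absurd hij (hlt i j h1 hj)
      · exact h1
      · exact absurd hij.symm (hlt j i h1 hi)
    · intro j _
      rw [div_le_iff₀ hlR, mul_comm]
      exact hB _ (isWordOf_wordOf (h.1.translate_mem hσ _) l) (by simp)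
    · intro t ht ω hω
      refine ⟨t, by omega, by omega, ?_⟩
      have h1 := wordOf_ztranslate_congr hω (k := t) (m := m) (by omega)
      rw [h1, ztranslate_ztranslate, sub_add_cancel]
      exact hk

end Occurrence

section PointwiseErgodic

variable {X : Type*} [MeasurableSpace X] {T : X → X} {μ : Measure X}

theorem birkhoffSum_measurable {f : X → ℝ} (hT : Measurable T) (hf : Measurable f) (n : ℕ) :
    Measurable (birkhoffSum T f n) := by
  unfold birkhoffSum
  exact Finset.measurable_sum _ fun i _ => hf.comp (hT.iterate i)

/-- The **maximal ergodic inequality** of Hopf, for bounded functions. -/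
theorem MeasureTheory.MeasurePreserving.integral_nonneg_of_birkhoffSum_pos [IsFiniteMeasure μ]
    (hT : MeasurePreserving T μ μ) {f : X → ℝ} (hf : Measurable f) {D : ℝ}
    (hD : ∀ x, |f x| ≤ D) (hpos : ∀ᵐ x ∂μ, ∃ n, 0 < birkhoffSum T f n x) :
    0 ≤ ∫ x, f x ∂μ := by
  let M : ℕ → X → ℝ := fun N x => (Finset.range (N + 1)).sup' Finset.nonempty_range_add_one
    fun n => birkhoffSum T f n x
  have hle : ∀ {N n x}, n ≤ N → birkhoffSum T f n x ≤ M N x := fun {N n x} hn =>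
    Finset.le_sup' (fun n => birkhoffSum T f n x) (Finset.mem_range.2 (by omega))
  have hM0 : ∀ N x, 0 ≤ M N x := fun N x => by
    simpa using hle (x := x) (Nat.zero_le N)
  have hMmeas : ∀ N, Measurable (M N) := fun N => by
    have := Finset.measurable_sup' (f := fun n => birkhoffSum T f n)
      (Finset.nonempty_range_add_one (n := N)) fun n _ => birkhoffSum_measurable hT.measurable hf n
    convert this using 1
    funext x; simp [M, Finset.sup'_apply]
  have hMbd : ∀ N x, |M N x| ≤ N * D := fun N x => by
    rw [abs_of_nonneg (hM0 N x)]
    refine Finset.sup'_le _ _ fun n hn => ?_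
    have hD0 : 0 ≤ D := (abs_nonneg _).trans (hD x)
    calc birkhoffSum T f n x ≤ ∑ i ∈ Finset.range n, D :=
          Finset.sum_le_sum fun i _ => (le_abs_self _).trans (hD _)
      _ = n * D := by simp
      _ ≤ N * D := by
          have : (n : ℝ) ≤ N := by exact_mod_cast Nat.lt_succ_iff.1 (Finset.mem_range.1 hn)
          gcongr
  have hMint : ∀ N, Integrable (M N) μ := fun N =>
    Integrable.of_bound (hMmeas N).aestronglyMeasurable _ (ae_of_all _ (hMbd N))
  have hfint : Integrable f μ := Integrable.of_bound hf.aestronglyMeasurable D (ae_of_all _ hD)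
  have hset : ∀ N, MeasurableSet {x | 0 < M N x} := fun N =>
    measurableSet_lt measurable_const (hMmeas N)
  have hstep : ∀ N x, M N x - M N (T x) ≤ {x | 0 < M N x}.indicator f x := fun N x => by
    by_cases hx : 0 < M N x
    · rw [indicator_of_mem (by exact hx)]
      suffices M N x ≤ f x + M N (T x) by linarith
      obtain ⟨n, hn, hmax⟩ := Finset.exists_mem_eq_sup' (Finset.nonempty_range_add_one (n := N))
        fun n => birkhoffSum T f n x
      have hMx : M N x = birkhoffSum T f n x := hmax
      rw [hMx]
      cases n with
      | zero => rw [hMx] at hx; simp at hx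
      | succ n =>
        rw [birkhoffSum_succ']
        have := hle (x := T x) (N := N) (n := n)
          (by have := Finset.mem_range.1 hn; omega)
        linarith
    · rw [indicator_of_notMem (by exact hx)]
      have := hM0 N (T x)
      linarith
  have hint : ∀ N, 0 ≤ ∫ x, {x | 0 < M N x}.indicator f x ∂μ := fun N => by
    have hcomp : ∫ x, M N (T x) ∂μ = ∫ x, M N x ∂μ := by
      conv_rhs => rw [← hT.map_eq]
      rw [integral_map hT.aemeasurable (hMmeas N).aestronglyMeasurable]
    have hTint : Integrable (fun x => M N (T x)) μ := hT.integrable_comp_of_integrable (hMint N)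
    have h1 : ∫ x, (M N x - M N (T x)) ∂μ = 0 := by
      rw [integral_sub (hMint N) hTint, hcomp, sub_self]
    exact h1.ge.trans
      (integral_mono ((hMint N).sub hTint) (hfint.indicator (hset N)) (hstep N))
  refine ge_of_tendsto' (tendsto_integral_of_dominated_convergence (fun _ => D) (fun N =>
    (hf.indicator (hset N)).aestronglyMeasurable) (integrable_const D) ?_ ?_) hint
  · intro N
    refine ae_of_all _ fun x => ?_
    exact (norm_indicator_le_norm_self _ _).trans (hD x)
  · filter_upwards [hpos] with x ⟨n, hn⟩
    refine tendsto_const_nhds.congr' ?_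
    filter_upwards [eventually_ge_atTop n] with N hN
    rw [indicator_of_mem]
    exact hn.trans_le (hle hN)

theorem Ergodic.ae_bddAbove_birkhoffSum [IsFiniteMeasure μ] (hT : Ergodic T μ) {f : X → ℝ}
    (hf : Measurable f) {D : ℝ} (hD : ∀ x, |f x| ≤ D) (hneg : ∫ x, f x ∂μ < 0) :
    ∀ᵐ x ∂μ, ∃ K : ℕ, ∀ n, birkhoffSum T f n x ≤ K := by
  set E : Set X := {x | ∃ K : ℕ, ∀ n, birkhoffSum T f n x ≤ K} with hE
  have hEm : MeasurableSet E := by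
    have : E = ⋃ K : ℕ, ⋂ n, {x | birkhoffSum T f n x ≤ K} := by ext; simp [hE]
    rw [this]
    exact MeasurableSet.iUnion fun K => MeasurableSet.iInter fun n =>
      measurableSet_le (birkhoffSum_measurable hT.measurable hf n) measurable_const
  have hinv : T ⁻¹' E = E := by
    ext x
    have hx := abs_le.1 (hD x)
    constructor
    · rintro ⟨K, hK⟩
      refine ⟨K + ⌈D⌉₊, fun n => ?_⟩
      have h2 := Nat.le_ceil D
      cases n with
      | zero => simp; positivity
      | succ n =>
        rw [birkhoffSum_succ']
        have h1 := hK n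
        push_cast
        linarith
    · rintro ⟨K, hK⟩
      refine ⟨K + ⌈D⌉₊, fun n => ?_⟩
      have h1 := hK (n + 1)
      rw [birkhoffSum_succ'] at h1
      have h2 := Nat.le_ceil D
      push_cast
      linarith
  rcases hT.toPreErgodic.ae_mem_or_ae_notMem hEm hinv with h | h
  · exact h
  · exfalso
    refine absurd (hT.toMeasurePreserving.integral_nonneg_of_birkhoffSum_pos hf hD ?_)
      (not_le.2 hneg)
    filter_upwards [h] with x hx
    by_contra! hcon
    exact hx ⟨0, by simpa using hcon⟩

theorem Ergodic.ae_eventually_birkhoffSum_le [IsProbabilityMeasure μ] (hT : Ergodic T μ)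
    {f : X → ℝ} (hf : Measurable f) {D : ℝ} (hD : ∀ x, |f x| ≤ D) {c : ℝ}
    (hc : ∫ x, f x ∂μ < c) :
    ∀ᵐ x ∂μ, ∀ᶠ n : ℕ in atTop, birkhoffSum T f n x ≤ c * n := by
  obtain ⟨b, hb1, hb2⟩ := exists_between hc
  have hfint : Integrable f μ := Integrable.of_bound hf.aestronglyMeasurable D (ae_of_all _ hD)
  have := hT.ae_bddAbove_birkhoffSum (f := fun x => f x - b) (D := D + |b|)
    (hf.sub_const b) (fun x => (abs_sub _ _).trans (by gcongr; exact hD x)) (by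
      rw [integral_sub hfint (integrable_const b)]
      simpa using hb1)
  filter_upwards [this] with x ⟨K, hK⟩
  filter_upwards [eventually_ge_atTop ⌈K / (c - b)⌉₊] with n hn
  have h1 : birkhoffSum T (fun x => f x - b) n x = birkhoffSum T f n x - n * b := by
    simp [birkhoffSum, Finset.sum_sub_distrib]
  have h2 := hK n
  have h3 : K / (c - b) ≤ n := (Nat.le_ceil _).trans (by exact_mod_cast hn)
  rw [div_le_iff₀ (by linarith)] at h3
  rw [h1] at h2
  linarith

/-- **Birkhoff's pointwise ergodic theorem** for bounded functions and ergodic measures. -/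
theorem Ergodic.ae_tendsto_birkhoffSum_div [IsProbabilityMeasure μ] (hT : Ergodic T μ)
    {f : X → ℝ} (hf : AEMeasurable f μ) {D : ℝ} (hD : ∀ x, |f x| ≤ D) :
    ∀ᵐ x ∂μ, Tendsto (fun n : ℕ => birkhoffSum T f n x / n) atTop (nhds (∫ x, f x ∂μ)) := by
  obtain ⟨g, hg, hgD, hfg⟩ : ∃ g : X → ℝ, Measurable g ∧ (∀ x, |g x| ≤ D) ∧ f =ᵐ[μ] g := by
    refine ⟨fun x => max (-D) (min D (hf.mk f x)), ?_, fun x => ?_, ?_⟩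
    · exact measurable_const.max (measurable_const.min hf.measurable_mk)
    · have : 0 ≤ D := (abs_nonneg _).trans (hD x)
      exact abs_le.2 ⟨le_max_left _ _, max_le (by linarith) (min_le_left _ _)⟩
    · filter_upwards [hf.ae_eq_mk] with x hx
      have := abs_le.1 (hD x)
      rw [← hx, min_eq_right this.2, max_eq_right this.1]
  have hsum : ∀ᵐ x ∂μ, ∀ i : ℕ, f (T^[i] x) = g (T^[i] x) := ae_all_iff.2 fun i =>
    (hT.toMeasurePreserving.iterate i).quasiMeasurePreserving.ae hfg
  have hint := integral_congr_ae hfg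
  rw [hint]
  have hup : ∀ᵐ x ∂μ, ∀ k : ℕ, ∀ᶠ n : ℕ in atTop,
      birkhoffSum T g n x ≤ (∫ x, g x ∂μ + 1 / (k + 1)) * n :=
    ae_all_iff.2 fun k => hT.ae_eventually_birkhoffSum_le hg hgD (by
      have : (0 : ℝ) < 1 / (k + 1) := by positivity
      linarith)
  have hlow : ∀ᵐ x ∂μ, ∀ k : ℕ, ∀ᶠ n : ℕ in atTop,
      birkhoffSum T (fun x => - g x) n x ≤ (∫ x, - g x ∂μ + 1 / (k + 1)) * n :=
    ae_all_iff.2 fun k => hT.ae_eventually_birkhoffSum_le (f := fun x => - g x) hg.neg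
      (by simpa using hgD) (by
      have : (0 : ℝ) < 1 / (k + 1) := by positivity
      linarith)
  filter_upwards [hsum, hup, hlow] with x hx h1 h2
  have hfg' : ∀ n, birkhoffSum T f n x = birkhoffSum T g n x := fun n =>
    Finset.sum_congr rfl fun i _ => hx i
  simp_rw [hfg']
  rw [Metric.tendsto_atTop']
  intro ε hε
  obtain ⟨k, hk⟩ := exists_nat_one_div_lt hε
  have h3 := ((h1 k).and (h2 k)).and (eventually_gt_atTop 0)
  obtain ⟨N, hN⟩ := eventually_atTop.1 h3
  refine ⟨N, fun n hn => ?_⟩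
  obtain ⟨⟨ha, hb⟩, hpos⟩ := hN n hn.le
  have hn0 : (0 : ℝ) < n := by exact_mod_cast hpos
  have hneg : birkhoffSum T (fun x => - g x) n x = - birkhoffSum T g n x := by
    simp [birkhoffSum]
  rw [hneg, integral_neg] at hb
  rw [Real.dist_eq, abs_lt]
  constructor
  · rw [lt_sub_iff_add_lt, lt_div_iff₀ hn0]; nlinarith
  · rw [sub_lt_iff_lt_add, div_lt_iff₀ hn0]; nlinarith

end PointwiseErgodic

/-- A discrete intermediate value theorem for sequences with bounded increments. -/
theorem exists_mem_Ioc_of_abs_sub_le {s : ℤ → ℝ} {d τ : ℝ} (hs : ∀ i, |s (i + 1) - s i| ≤ d)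
    (h0 : s 0 ≤ τ) (hk : ∃ k, τ < s k) : ∃ i, τ < s i ∧ s i ≤ τ + d := by
  classical
  have key : ∀ s : ℤ → ℝ, (∀ i, |s (i + 1) - s i| ≤ d) → s 0 ≤ τ → (∃ k : ℕ, τ < s k) →
      ∃ i, τ < s i ∧ s i ≤ τ + d := by
    intro s hs h0 hex
    refine ⟨_, Nat.find_spec hex, ?_⟩
    cases hn : Nat.find hex with
    | zero =>
      have := Nat.find_spec hex
      rw [hn] at this
      exact absurd h0 (not_le.2 (by simpa using this))
    | succ n =>
      have h1 : ¬ τ < s n := Nat.find_min hex (by omega)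
      have h2 := (abs_le.1 (hs n)).2
      push_cast
      linarith
  obtain ⟨k, hk⟩ := hk
  rcases le_total 0 k with h | h
  · lift k to ℕ using h
    exact key s hs h0 ⟨k, hk⟩
  · obtain ⟨i, hi⟩ := key (fun i => s (-i)) (fun i => by
      rw [abs_sub_comm]
      have := hs (-(i + 1))
      rwa [show -(i + 1) + 1 = -i by ring] at this) (by simpa using h0)
      ⟨(-k).toNat, by
        have : (-((-k).toNat : ℤ)) = k := by omega
        rwa [this]⟩
    exact ⟨-i, hi⟩

section UniformUpperBound

variable {𝒜 : Type*} [Fintype 𝒜] [TopologicalSpace 𝒜] [DiscreteTopology 𝒜] [MeasurableSpace 𝒜]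
  {Ω : Set (ℤ → 𝒜)} {ν : Measure (ℤ → 𝒜)}

theorem birkhoffSum_wordOf_congr {𝒜 : Type*} {f : List 𝒜 → ℝ} {n L : ℕ} {ω ρ : ℤ → 𝒜}
    (h : wordOf ω (L + n) = wordOf ρ (L + n)) :
    birkhoffSum (shift 𝒜) (fun ω => f (wordOf ω n)) L ω
      = birkhoffSum (shift 𝒜) (fun ω => f (wordOf ω n)) L ρ := by
  refine Finset.sum_congr rfl fun k hk => ?_
  have := Finset.mem_range.1 hk
  simp only [shift_iterate]
  rw [wordOf_ztranslate_congr h (by omega)]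

theorem IsMinimalSubshift.integral_birkhoffSum (h : IsMinimalSubshift Ω)
    [IsProbabilityMeasure ν] (hν : ν Ωᶜ = 0) (hinv : MeasurePreserving (shift 𝒜) ν ν)
    (f : List 𝒜 → ℝ) (n L : ℕ) :
    Integrable (birkhoffSum (shift 𝒜) (fun ω => f (wordOf ω n)) L) ν ∧
    ∫ ω, birkhoffSum (shift 𝒜) (fun ω => f (wordOf ω n)) L ω ∂ν
      = L * ∫ ω, f (wordOf ω n) ∂ν := by
  have h0 : AEMeasurable (fun ω => f (wordOf ω n)) ν := by
    simpa using h.aemeasurable_wordOf hν 0 n f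
  have heq : birkhoffSum (shift 𝒜) (fun ω => f (wordOf ω n)) L
      = fun ω => ∑ k ∈ Finset.range L, f (wordOf (ztranslate (k : ℤ) ω) n) := by
    funext ω; simp [birkhoffSum, shift_iterate]
  constructor
  · rw [heq]
    exact integrable_finsetSum _ fun k _ => h.integrable_wordOf hν k n f
  · rw [heq]
    beta_reduce
    rw [integral_finsetSum _ fun (k : ℕ) _ => h.integrable_wordOf hν k n f]
    simp_rw [fun k : ℕ => integral_comp_ztranslate hinv h0 k]
    simp

/-- On all of `Ω`, suitable averages of locally constant functions are at most marginally larger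
than the mean with respect to `ν`. -/
def HasUniformUpperAverages {𝒜 : Type*} [MeasurableSpace 𝒜] (Ω : Set (ℤ → 𝒜))
    (ν : Measure (ℤ → 𝒜)) : Prop :=
  ∀ (f : List 𝒜 → ℝ) (n : ℕ) (ε : ℝ), 0 < ε → ∃ L : ℕ, 1 ≤ L ∧ ∀ ω ∈ Ω,
    birkhoffSum (shift 𝒜) (fun ω => f (wordOf ω n)) L ω ≤ L * (∫ ω, f (wordOf ω n) ∂ν + ε)

theorem IsMinimalSubshift.hasUniformUpperAverages (h : IsMinimalSubshift Ω)
    [IsProbabilityMeasure ν] (hν : ν Ωᶜ = 0) (herg : Ergodic (shift 𝒜) ν)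
    {C : ℝ} (hC : 0 < C) {l : ℕ → ℕ} (hl : Tendsto l atTop atTop)
    (hB : ∀ i, ∀ w : List 𝒜, IsWordOf Ω w → w.length = l i →
      C ≤ l i * ν.real {ω | wordOf ω (l i) = w}) :
    HasUniformUpperAverages Ω ν := by
  intro f n ε hε
  by_contra! hcon
  obtain ⟨D₀, hD₀, hfD₀⟩ := exists_bound_wordOf n f
  obtain ⟨D, hD, hfD⟩ : ∃ D : ℝ, 0 < D ∧ ∀ ω, |f (wordOf ω n)| ≤ D :=
    ⟨D₀ + 1, by linarith, fun ω => by have := hfD₀ ω; linarith⟩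
  set g : (ℤ → 𝒜) → ℝ := fun ω => f (wordOf ω n) with hg
  set θ := ∫ ω, g ω ∂ν with hθ
  have hgm : AEMeasurable g ν := by simpa using h.aemeasurable_wordOf hν 0 n f
  set A : ℕ → Set (ℤ → 𝒜) := fun L => {ω | ε / 2 ≤ dist (birkhoffSum (shift 𝒜) g L ω / L) θ}
  have hA : Tendsto (fun L => ν.real (A L)) atTop (nhds 0) := by
    have := tendstoInMeasure_of_tendsto_ae (μ := ν)
      (f := fun L ω => birkhoffSum (shift 𝒜) g L ω / L) (g := fun _ => θ) (fun L =>
        ((h.integral_birkhoffSum hν herg.toMeasurePreserving f n L).1.div_const _).1)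
      (herg.ae_tendsto_birkhoffSum_div hgm hfD)
    rw [tendstoInMeasure_iff_dist] at this
    have := (ENNReal.tendsto_toReal ENNReal.zero_ne_top).comp (this (ε / 2) (half_pos hε))
    exact this
  have hlow : ∀ i, n < l i → (((l i - n : ℕ) : ℝ) * ε / (4 * D) - 1) * (C / l i)
      ≤ ν.real (A (l i - n)) := by
    intro i hi
    set L := l i - n with hL
    have hLn : L + n = l i := by omega
    have hlpos : (0 : ℝ) < l i := by exact_mod_cast (by omega : 0 < l i)
    have hLpos : (0 : ℝ) < L := by exact_mod_cast (by omega : 0 < L)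
    obtain ⟨ω, hω, hωL⟩ := hcon L (by omega)
    obtain ⟨hint, hintθ⟩ := h.integral_birkhoffSum hν herg.toMeasurePreserving f n L
    obtain ⟨ρ, hρ, hρL⟩ := exists_notMem_null_le_integral hint hν
    rw [hintθ] at hρL
    rw [notMem_compl_iff] at hρ
    obtain ⟨k, hk⟩ := h.exists_translate hρ (isWordOf_wordOf hω (L + n))
    rw [length_wordOf] at hk
    have hk' := birkhoffSum_wordOf_congr (f := f) hk
    set s : ℤ → ℝ := fun i => birkhoffSum (shift 𝒜) g L (ztranslate i ρ) with hs
    have hstep : ∀ i, |s (i + 1) - s i| ≤ 2 * D := fun i => by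
      have h1 : ztranslate (i + 1) ρ = shift 𝒜 (ztranslate i ρ) := by
        rw [shift_eq_ztranslate, ztranslate_ztranslate]
      simp only [hs]
      rw [h1, birkhoffSum_apply_sub_birkhoffSum]
      refine (abs_sub _ _).trans ?_
      have h2 := hfD ((shift 𝒜)^[L] (ztranslate i ρ))
      have h3 := hfD (ztranslate i ρ)
      linarith
    have hs0 : s 0 ≤ L * θ := by simpa [hs] using hρL
    have hsk : L * (θ + ε) < s k := by
      simp only [hs]; rw [hk']; exact hωL
    set K := ⌊L * ε / (4 * D)⌋₊ with hK
    have hKle : (K : ℝ) * (4 * D) ≤ L * ε := by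
      rw [← le_div_iff₀ (by positivity)]
      exact Nat.floor_le (by positivity)
    have hLε : 0 < L * ε := by positivity
    have hex : ∀ j : ℕ, ∃ i, j < K → L * (θ + ε / 2) + 2 * D * j < s i ∧
        s i ≤ L * (θ + ε / 2) + 2 * D * (j + 1) := by
      intro j
      by_cases hj : j < K
      · have hjK : (j : ℝ) * (4 * D) ≤ K * (4 * D) := by gcongr
        obtain ⟨i, hi⟩ := exists_mem_Ioc_of_abs_sub_le (τ := L * (θ + ε / 2) + 2 * D * j) hstep
          (by have : 0 ≤ 2 * D * j := by positivity
              linarith) ⟨k, by linarith⟩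
        exact ⟨i, fun _ => ⟨hi.1, by linarith [hi.2]⟩⟩
      · exact ⟨0, fun hj' => absurd hj' hj⟩
    choose t ht using hex
    have hcard := h.card_mul_le_measureReal hν (K := K) (l := l i)
      (x := fun j => wordOf (ztranslate (t j) ρ) (l i)) (c := C / l i) (A := A L) ?_ ?_ ?_
    · refine le_trans ?_ hcard
      gcongr
      have := Nat.lt_floor_add_one (L * ε / (4 * D))
      rw [← hK] at this
      linarith
    · intro a ha b hb hab
      have hab' : s (t a) = s (t b) := birkhoffSum_wordOf_congr (f := f) (by rw [hLn]; exact hab)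
      have h1 := ht a ha
      have h2 := ht b hb
      rw [hab'] at h1
      have h3 : (2 * D) * a < (2 * D) * (b + 1) := by linarith
      have h4 : (2 * D) * b < (2 * D) * (a + 1) := by linarith
      have h5 := lt_of_mul_lt_mul_left h3 (by positivity)
      have h6 := lt_of_mul_lt_mul_left h4 (by positivity)
      have h7 : a < b + 1 := by exact_mod_cast h5
      have h8 : b < a + 1 := by exact_mod_cast h6
      omega
    · intro j _
      rw [div_le_iff₀ hlpos, mul_comm]
      exact hB i _ (isWordOf_wordOf (h.1.translate_mem hρ _) _) (length_wordOf _ _)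
    · intro j hj σ hσ
      have h1 : birkhoffSum (shift 𝒜) g L σ = s (t j) :=
        birkhoffSum_wordOf_congr (f := f) (by rw [hLn]; exact hσ)
      have h2 := (ht j hj).1
      have h3 : (0 : ℝ) ≤ 2 * D * j := by positivity
      have h4 : θ + ε / 2 ≤ birkhoffSum (shift 𝒜) g L σ / L := by
        rw [le_div_iff₀ hLpos, h1]; linarith
      show ε / 2 ≤ dist _ _
      rw [Real.dist_eq]
      exact le_trans (by linarith) (le_abs_self _)
  have hlim : Tendsto (fun i => l i - n) atTop atTop := tendsto_sub_atTop_nat n |>.comp hl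
  have hl' : Tendsto (fun i => (l i : ℝ)) atTop atTop := tendsto_natCast_atTop_atTop.comp hl
  have h1 : Tendsto (fun i => (((l i : ℝ) - n) * ε / (4 * D) - 1) * (C / l i)) atTop
      (nhds (C * ε / (4 * D))) := by
    have h2 : Tendsto (fun i => C * ε / (4 * D) - (n * ε / (4 * D) + 1) * C * (l i : ℝ)⁻¹) atTop
        (nhds (C * ε / (4 * D) - (n * ε / (4 * D) + 1) * C * 0)) :=
      tendsto_const_nhds.sub (tendsto_const_nhds.mul (tendsto_inv_atTop_zero.comp hl'))
    rw [mul_zero, sub_zero] at h2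
    refine h2.congr' ?_
    filter_upwards [hl.eventually_gt_atTop 0] with i hi
    have : (l i : ℝ) ≠ 0 := by exact_mod_cast hi.ne'
    field_simp
    ring
  have h3 : C * ε / (4 * D) ≤ 0 := by
    refine le_of_tendsto_of_tendsto h1 (hA.comp hlim) ?_
    filter_upwards [hl.eventually_gt_atTop n] with i hi
    have := hlow i hi
    rwa [Nat.cast_sub hi.le] at this
  have : 0 < C * ε / (4 * D) := by positivity
  linarith

end UniformUpperBound

section UniqueErgodicity

variable {𝒜 : Type*} [Fintype 𝒜] [TopologicalSpace 𝒜] [DiscreteTopology 𝒜] [MeasurableSpace 𝒜]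
  {Ω : Set (ℤ → 𝒜)} {ν μ : Measure (ℤ → 𝒜)}

theorem IsMinimalSubshift.integral_wordOf_le (h : IsMinimalSubshift Ω)
    (hu : HasUniformUpperAverages Ω ν)
    [IsProbabilityMeasure μ] (hμ : μ Ωᶜ = 0) (hinv : MeasurePreserving (shift 𝒜) μ μ)
    (f : List 𝒜 → ℝ) (n : ℕ) :
    ∫ ω, f (wordOf ω n) ∂μ ≤ ∫ ω, f (wordOf ω n) ∂ν := by
  refine le_of_forall_pos_le_add fun ε hε => ?_
  obtain ⟨L, hL, hle⟩ := hu f n ε hε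
  obtain ⟨hint, heq⟩ := h.integral_birkhoffSum hμ hinv f n L
  have h1 := integral_mono_ae hint
    (integrable_const ((L : ℝ) * (∫ ω, f (wordOf ω n) ∂ν + ε)))
    (measure_mono_null (fun ω hω hmem => hω (hle ω hmem)) hμ)
  rw [heq] at h1
  have hL0 : (0 : ℝ) < L := by exact_mod_cast hL
  exact le_of_mul_le_mul_left (by simpa using h1) hL0

theorem IsMinimalSubshift.integral_indicator_wordOf (h : IsMinimalSubshift Ω)
    [IsProbabilityMeasure μ] (hμ : μ Ωᶜ = 0) (n : ℕ) (S : Set (List 𝒜)) :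
    ∫ ω, S.indicator (fun _ => (1 : ℝ)) (wordOf ω n) ∂μ = μ.real {ω | wordOf ω n ∈ S} := by
  have h0 : NullMeasurableSet {ω : ℤ → 𝒜 | wordOf ω n ∈ S} μ := by
    simpa using h.nullMeasurableSet_wordOf hμ 0 n S
  have : (fun ω : ℤ → 𝒜 => S.indicator (fun _ => (1 : ℝ)) (wordOf ω n))
      = {ω | wordOf ω n ∈ S}.indicator fun _ => 1 := by
    funext ω; rfl
  rw [this, integral_indicator₀ h0, setIntegral_const, smul_eq_mul, mul_one]

theorem IsMinimalSubshift.eq_of_hasUniformUpperAverages (h : IsMinimalSubshift Ω)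
    [IsProbabilityMeasure ν] (hν : ν Ωᶜ = 0) (hνinv : MeasurePreserving (shift 𝒜) ν ν)
    (hu : HasUniformUpperAverages Ω ν)
    [IsProbabilityMeasure μ] (hμ : μ Ωᶜ = 0) (hinv : MeasurePreserving (shift 𝒜) μ μ) :
    μ = ν := by
  have hint : ∀ (f : List 𝒜 → ℝ) n, ∫ ω, f (wordOf ω n) ∂μ = ∫ ω, f (wordOf ω n) ∂ν := by
    intro f n
    refine le_antisymm (h.integral_wordOf_le hu hμ hinv f n) ?_
    have := h.integral_wordOf_le hu hμ hinv (fun w => - f w) n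
    rw [integral_neg, integral_neg] at this
    linarith
  have hword : ∀ n (S : Set (List 𝒜)), μ {ω | wordOf ω n ∈ S} = ν {ω | wordOf ω n ∈ S} := by
    intro n S
    have := hint (S.indicator fun _ => 1) n
    rw [h.integral_indicator_wordOf hμ, h.integral_indicator_wordOf hν] at this
    exact (measureReal_eq_measureReal_iff).1 this
  refine ext_of_generate_finite (measurableCylinders fun _ : ℤ => 𝒜)
    generateFrom_measurableCylinders.symm isPiSystem_measurableCylinders ?_ (by simp)
  intro A hA
  have hAm : MeasurableSet A := MeasurableSet.of_mem_measurableCylinders hA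
  obtain ⟨s, B, hB, rfl⟩ := (mem_measurableCylinders A).1 hA
  obtain ⟨N, hN⟩ : ∃ N : ℕ, ∀ i ∈ s, -(N : ℤ) ≤ i ∧ i ≤ N := by
    refine ⟨s.sup Int.natAbs, fun i hi => ?_⟩
    have := Finset.le_sup (f := Int.natAbs) hi
    omega
  set S : Set (List 𝒜) :=
    (fun ω => wordOf ω (2 * N + 1)) '' (ztranslate ((N + 1 : ℕ) : ℤ) ⁻¹' (cylinder s B)) with hS
  have hpre : ztranslate ((N + 1 : ℕ) : ℤ) ⁻¹' (cylinder s B)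
      = {ω : ℤ → 𝒜 | wordOf ω (2 * N + 1) ∈ S} := by
    ext ω
    refine ⟨fun hω => ⟨ω, hω, rfl⟩, ?_⟩
    rintro ⟨ρ, hρ, hρω⟩
    rw [mem_preimage, mem_cylinder] at hρ ⊢
    convert hρ using 1
    funext i
    have hi := hN i i.2
    have h1 := wordOf_ztranslate_congr hρω (k := (i + N : ℤ).toNat) (m := 1) (by omega)
    have h2 : 1 + (((i + N : ℤ).toNat : ℕ) : ℤ) = i + (N + 1 : ℕ) := by omega
    have h3 : ρ (1 + ((i + N : ℤ).toNat : ℕ)) = ω (1 + ((i + N : ℤ).toNat : ℕ)) := by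
      simpa [wordOf_eq_map, ztranslate_apply] using h1
    rw [h2] at h3
    exact h3.symm
  rw [← measure_preimage_ztranslate hinv hAm.nullMeasurableSet (N + 1),
    ← measure_preimage_ztranslate hνinv hAm.nullMeasurableSet (N + 1), hpre, hword]

end UniqueErgodicity

section Subadditive

variable {𝒜 : Type*} [TopologicalSpace 𝒜]
  {Ω : Set (ℤ → 𝒜)} {F : List 𝒜 → ℝ}

theorem SubadditiveOn.wordOf_add_le (hF : SubadditiveOn Ω F) (h : IsSubshift Ω)
    {ω : ℤ → 𝒜} (hω : ω ∈ Ω) (a b : ℕ) :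
    F (wordOf ω (a + b)) ≤ F (wordOf ω a) + F (wordOf (ztranslate a ω) b) := by
  rw [wordOf_add]
  refine hF _ _ (isWordOf_wordOf hω a) (isWordOf_wordOf (h.translate_mem hω _) b) ?_
  rw [← wordOf_add]
  exact isWordOf_wordOf hω _

theorem SubadditiveOn.sum_wordOf_le (hF : SubadditiveOn Ω F) (h : IsSubshift Ω)
    {ω : ℤ → 𝒜} (hω : ω ∈ Ω) (n m : ℕ) :
    ∑ r ∈ Finset.range n, F (wordOf (ztranslate (r : ℤ) ω) (m * n))
      ≤ n * F [] + birkhoffSum (shift 𝒜) (fun ω => F (wordOf ω n)) (m * n) ω := by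
  induction m with
  | zero => simp [wordOf]
  | succ m ih =>
    rw [Nat.succ_mul, birkhoffSum_add, ← add_assoc]
    refine le_trans (Finset.sum_le_sum fun r _ =>
      hF.wordOf_add_le h (h.translate_mem hω r) (m * n) n) ?_
    rw [Finset.sum_add_distrib]
    refine add_le_add ih (Finset.sum_le_sum fun r _ => le_of_eq ?_)
    simp only [shift_iterate, ztranslate_ztranslate]
    rw [add_comm]

theorem birkhoffSum_mul_le {X : Type*} {T : X → X} {g : X → ℝ} {s : Set X} {L : ℕ} {b : ℝ}
    (hs : ∀ x ∈ s, T x ∈ s) (hb : ∀ x ∈ s, birkhoffSum T g L x ≤ b) (k : ℕ) {x : X}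
    (hx : x ∈ s) : birkhoffSum T g (k * L) x ≤ k * b := by
  induction k with
  | zero => simp
  | succ k ih =>
    rw [Nat.succ_mul, birkhoffSum_add]
    have hmem : ∀ j, T^[j] x ∈ s := fun j => by
      induction j with
      | zero => exact hx
      | succ j ih => rw [Function.iterate_succ_apply']; exact hs _ ih
    have := hb _ (hmem (k * L))
    push_cast
    linarith

theorem exists_bound_wordOf_le {𝒜 : Type*} [Fintype 𝒜] (F : List 𝒜 → ℝ) (J : ℕ) :
    ∃ B, 0 ≤ B ∧ ∀ j ≤ J, ∀ ω, |F (wordOf ω j)| ≤ B := by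
  choose D hD0 hD using fun j => exists_bound_wordOf j F
  exact ⟨∑ j ∈ Finset.range (J + 1), D j, Finset.sum_nonneg fun j _ => hD0 j, fun j hj ω =>
    (hD j ω).trans (Finset.single_le_sum (f := D) (fun i _ => hD0 i)
      (Finset.mem_range.2 (by omega)))⟩

/-- A subadditive function whose mean over words of length `n` is less than `n * c` is at most
`c * N` plus a constant on words of length `N`. -/
theorem SubadditiveOn.exists_wordOf_le [Fintype 𝒜] [MeasurableSpace 𝒜] {ν : Measure (ℤ → 𝒜)}
    (hF : SubadditiveOn Ω F) (h : IsSubshift Ω)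
    (hu : HasUniformUpperAverages Ω ν) {n : ℕ} (hn : 1 ≤ n) {c : ℝ}
    (hc : ∫ ω, F (wordOf ω n) ∂ν < n * c) :
    ∃ K, ∀ N, ∀ ω ∈ Ω, F (wordOf ω N) ≤ c * N + K := by
  obtain ⟨L, hL, hle⟩ := hu F n (n * c - ∫ ω, F (wordOf ω n) ∂ν) (by linarith)
  obtain ⟨B, hB0, hB⟩ := exists_bound_wordOf_le F (n + L * n)
  rw [add_sub_cancel] at hle
  have hn0 : (0 : ℝ) < n := by exact_mod_cast hn
  refine ⟨3 * B + |c| * (n + L * n), fun N ω hω => ?_⟩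
  have hcb : ∀ t : ℕ, t ≤ n + L * n → - (|c| * (n + L * n)) ≤ c * t := fun t ht => by
    have h1 : (t : ℝ) ≤ n + L * n := by exact_mod_cast ht
    have h2 : |c * t| ≤ |c| * (n + L * n) := by
      rw [abs_mul, Nat.abs_cast]; gcongr
    exact (abs_le.1 h2).1.trans' le_rfl
  rcases lt_or_ge N n with hN | hN
  · have h1 := hcb N (by omega)
    have h2 := (abs_le.1 (hB N (by omega) ω)).2
    linarith
  · obtain ⟨q, t, ht, hNq⟩ : ∃ q t, t < L * n ∧ N = (q * L) * n + (n + t) := by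
      refine ⟨(N - n) / (L * n), (N - n) % (L * n), Nat.mod_lt _ (by positivity), ?_⟩
      have := Nat.div_add_mod (N - n) (L * n)
      rw [mul_comm (L * n), ← mul_assoc] at this
      omega
    have h1 : ∀ r ∈ Finset.range n, F (wordOf ω N) ≤
        F (wordOf (ztranslate (r : ℤ) ω) (q * L * n)) + 2 * B := fun r hr => by
      have hr := Finset.mem_range.1 hr
      have hsplit : N = r + (q * L * n + (n + t - r)) := by omega
      have e1 := hF.wordOf_add_le h hω r (q * L * n + (n + t - r))
      have e2 := hF.wordOf_add_le h (h.translate_mem hω r) (q * L * n) (n + t - r)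
      have e3 := (abs_le.1 (hB r (by omega) ω)).2
      have e4 := (abs_le.1 (hB (n + t - r) (by omega)
        (ztranslate ((q * L * n : ℕ) : ℤ) (ztranslate (r : ℤ) ω)))).2
      rw [← hsplit] at e1
      linarith
    have h2 := Finset.sum_le_sum h1
    rw [Finset.sum_add_distrib] at h2
    simp only [Finset.sum_const, Finset.card_range, nsmul_eq_mul] at h2
    have h3 := hF.sum_wordOf_le h hω n (q * L)
    have h4 := birkhoffSum_mul_le (fun ω hω => by
      simpa [shift_eq_ztranslate] using h.translate_mem hω 1) hle (q * n) hω
    rw [show q * n * L = q * L * n by ring] at h4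
    have h5 : F [] ≤ B := by simpa [wordOf] using (abs_le.1 (hB 0 (by omega) ω)).2
    have h6 := hcb (n + t) (by omega)
    have hNR : (N : ℝ) = q * L * n + (n + t : ℕ) := by rw [hNq]; push_cast; ring
    rw [hNR]
    have h7 : (n : ℝ) * F (wordOf ω N) ≤ n * (3 * B + c * (q * L * n)) := by
      have : (n : ℝ) * F [] ≤ n * B := by gcongr
      push_cast at h4
      linarith
    have := le_of_mul_le_mul_left h7 hn0
    linarith

end Subadditive

theorem le_of_forall_wordOf_le {𝒜 : Type*} [MeasurableSpace 𝒜] {Ω : Set (ℤ → 𝒜)}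
    {ν : Measure (ℤ → 𝒜)} {F : List 𝒜 → ℝ} {Λ : EReal} [IsProbabilityMeasure ν] (hν : ν Ωᶜ = 0)
    (hΛ : ∀ᵐ ω ∂ν, Tendsto (fun n : ℕ => ((F (wordOf ω n) / (n : ℝ) : ℝ) : EReal))
      atTop (nhds Λ)) {c K : ℝ} (hK : ∀ N, ∀ ω ∈ Ω, F (wordOf ω N) ≤ c * N + K) :
    Λ ≤ c := by
  have hmem : ∀ᵐ ω ∂ν, ω ∈ Ω := hν
  obtain ⟨ω, hω, hmem⟩ := (hΛ.and hmem).exists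
  have h1 : Tendsto (fun n : ℕ => ((c + K / n : ℝ) : EReal)) atTop (nhds (c : EReal)) := by
    have : Tendsto (fun n : ℕ => c + K / n) atTop (nhds (c + 0)) :=
      tendsto_const_nhds.add (tendsto_const_div_atTop_nhds_zero_nat K)
    rw [add_zero] at this
    exact (continuous_coe_real_ereal.tendsto c).comp this
  refine le_of_tendsto_of_tendsto hω h1 ?_
  filter_upwards [eventually_gt_atTop 0] with n hn
  have hnR : (0 : ℝ) < n := by exact_mod_cast hn
  rw [EReal.coe_le_coe_iff, div_le_iff₀ hnR, add_mul, div_mul_cancel₀ _ hnR.ne']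
  exact hK n ω hmem

section SubadditiveLimit

variable {𝒜 : Type*} [Fintype 𝒜] [TopologicalSpace 𝒜] [DiscreteTopology 𝒜] [MeasurableSpace 𝒜]
  {Ω : Set (ℤ → 𝒜)} {ν : Measure (ℤ → 𝒜)} {F : List 𝒜 → ℝ} {Λ : EReal}

theorem SubadditiveOn.exists_integral_wordOf_lt (hF : SubadditiveOn Ω F)
    (h : IsMinimalSubshift Ω) [IsProbabilityMeasure ν] (hν : ν Ωᶜ = 0)
    (hΛ : ∀ᵐ ω ∂ν, Tendsto (fun n : ℕ => ((F (wordOf ω n) / (n : ℝ) : ℝ) : EReal))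
      atTop (nhds Λ)) {c : ℝ} (hc : Λ < c) :
    ∃ n, 1 ≤ n ∧ ∫ ω, F (wordOf ω n) ∂ν < n * c := by
  obtain ⟨c₁, hc₁, hc₂⟩ := EReal.lt_iff_exists_real_btwn.1 hc
  rw [EReal.coe_lt_coe_iff] at hc₂
  obtain ⟨B, hB0, hB⟩ := exists_bound_wordOf_le F 1
  have hgrow : ∀ n, ∀ ω ∈ Ω, F (wordOf ω n) ≤ B * (n + 1) := by
    intro n
    induction n with
    | zero => intro ω _; simpa using (abs_le.1 (hB 0 (by omega) ω)).2
    | succ n ih =>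
      intro ω hω
      have h1 := hF.wordOf_add_le h.1 hω n 1
      have h2 := ih ω hω
      have h3 := (abs_le.1 (hB 1 le_rfl (ztranslate n ω))).2
      push_cast
      linarith
  have hmem : ∀ᵐ ω ∂ν, ω ∈ Ω := hν
  have hlim : Tendsto (fun n : ℕ => ∫ ω, max (F (wordOf ω n) / n) c₁ ∂ν) atTop
      (nhds (∫ _, c₁ ∂ν)) := by
    refine tendsto_integral_of_dominated_convergence (fun _ => |c₁| + 2 * B) (fun n => ?_)
      (integrable_const _) (fun n => ?_) ?_
    · have := h.integrable_wordOf hν 0 n (fun w => max (F w / n) c₁)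
      simpa using this.1
    · filter_upwards [hmem] with ω hω
      have h1 := neg_abs_le c₁
      have h2 := le_abs_self c₁
      rw [Real.norm_eq_abs, abs_le]
      refine ⟨le_trans (by linarith) (le_max_right _ _), max_le ?_ (by linarith)⟩
      rcases Nat.eq_zero_or_pos n with rfl | hn
      · simp; positivity
      · have hnR : (1 : ℝ) ≤ n := by exact_mod_cast hn
        rw [div_le_iff₀ (by linarith)]
        have h3 := hgrow n ω hω
        have h4 := abs_nonneg c₁
        nlinarith
    · filter_upwards [hΛ] with ω hω
      refine tendsto_const_nhds.congr' ?_
      filter_upwards [hω.eventually_lt_const hc₁] with n hn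
      rw [EReal.coe_lt_coe_iff] at hn
      exact (max_eq_right hn.le).symm
  rw [integral_const, probReal_univ, one_smul] at hlim
  obtain ⟨n, hn1, hn⟩ := ((hlim.eventually_lt_const hc₂).and (eventually_ge_atTop 1)).exists
  refine ⟨n, hn, ?_⟩
  have hnR : (0 : ℝ) < n := by exact_mod_cast hn
  have h1 : ∫ ω, F (wordOf ω n) / n ∂ν ≤ ∫ ω, max (F (wordOf ω n) / n) c₁ ∂ν := by
    refine integral_mono ?_ ?_ fun ω => le_max_left _ _
    · simpa using h.integrable_wordOf hν 0 n (fun w => F w / n)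
    · simpa using h.integrable_wordOf hν 0 n (fun w => max (F w / n) c₁)
  rw [integral_div] at h1
  have h2 := h1.trans_lt hn1
  rwa [div_lt_iff₀ hnR, mul_comm] at h2

theorem SubadditiveOn.eventually_lt (hF : SubadditiveOn Ω F)
    (h : IsMinimalSubshift Ω) [IsProbabilityMeasure ν] (hν : ν Ωᶜ = 0)
    (hinv : MeasurePreserving (shift 𝒜) ν ν) (hu : HasUniformUpperAverages Ω ν)
    {C : ℝ} (hC : 0 < C) {l : ℕ → ℕ} (hl : Tendsto l atTop atTop)
    (hB : ∀ n, ∀ w : List 𝒜, IsWordOf Ω w → w.length = l n → C ≤ (ν (Uset Ω w)).toReal)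
    {r : ℝ} (hΛ : ∀ᵐ ω ∂ν, Tendsto (fun n : ℕ => ((F (wordOf ω n) / (n : ℝ) : ℝ) : EReal))
      atTop (nhds (r : EReal))) {a : ℝ} (ha : a < r) {w : ℕ → List 𝒜}
    (hw : ∀ n, IsWordOf Ω (w n)) (hwl : ∀ n, (w n).length = l n) :
    ∀ᶠ n in atTop, a < F (w n) / (w n).length := by
  set ε := C * (r - a) / 16 with hε
  have hε0 : 0 < ε := by have : 0 < r - a := by linarith
                         positivity
  obtain ⟨n₀, hn₀, hint⟩ := hF.exists_integral_wordOf_lt h hν hΛ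
    (EReal.coe_lt_coe_iff.2 (by linarith : r < r + ε))
  obtain ⟨K₀, hK₀⟩ := hF.exists_wordOf_le h.1 hu hn₀ hint
  obtain ⟨K, hK0, hK⟩ : ∃ K, 0 ≤ K ∧ ∀ N, ∀ ω ∈ Ω, F (wordOf ω N) ≤ (r + ε) * N + K :=
    ⟨max K₀ 0, le_max_right _ _, fun N ω hω =>
      (hK₀ N ω hω).trans (by have := le_max_left K₀ 0; linarith)⟩
  filter_upwards [hl.eventually_gt_atTop ⌈K / ε⌉₊] with n hn
  by_contra! hle
  have hmK : K < ε * (w n).length := by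
    rw [hwl, mul_comm, ← div_lt_iff₀ hε0]
    exact (Nat.le_ceil _).trans_lt (by exact_mod_cast hn)
  have hUC := hB n (w n) (hw n) (hwl n)
  set v := w n with hv
  set m := v.length with hm
  have hm0 : 0 < m := by rw [hm, hwl]; omega
  have hmR : (0 : ℝ) < m := by exact_mod_cast hm0
  rw [div_le_iff₀ hmR] at hle
  rw [h.measure_Uset hν hinv v m] at hUC
  set G : Set (ℤ → 𝒜) := {ω | ∃ j, m ≤ j ∧ j < m + m ∧ wordOf (ztranslate (j : ℤ) ω) m = v}
    with hG
  have hGm : NullMeasurableSet G ν := by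
    simpa using h.nullMeasurableSet_occurs hν v m (m + m) 0 m
  have hptw : ∀ ω ∈ Ω, F (wordOf ω (4 * m)) ≤
      ((r + ε) * (4 * m) + 2 * K) - G.indicator (fun _ => (r + ε - a) * m) ω := by
    intro ω hω
    by_cases hωG : ω ∈ G
    · rw [indicator_of_mem hωG]
      obtain ⟨j, hj1, hj2, hj⟩ := hωG
      obtain ⟨s, hs⟩ := Nat.exists_eq_add_of_le (show j + m ≤ 4 * m by omega)
      have e1 := hF.wordOf_add_le h.1 hω j (m + s)
      have e2 := hF.wordOf_add_le h.1 (h.1.translate_mem hω j) m s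
      have e3 := hK j ω hω
      have e4 := hK s _ (h.1.translate_mem (h.1.translate_mem hω j) m)
      rw [hj] at e2
      rw [hs, add_assoc]
      have hsR : (4 : ℝ) * m = j + m + s := by exact_mod_cast hs
      have : (s : ℝ) = 3 * m - j := by linarith
      rw [this] at e4
      nlinarith
    · rw [indicator_of_notMem hωG]
      have := hK (4 * m) ω hω
      push_cast at this
      linarith
  have hIind : Integrable (G.indicator fun _ => (r + ε - a) * m) ν :=
    (integrable_const _).indicator₀ hGm
  have hmono : ∫ ω, F (wordOf ω (4 * m)) ∂ν ≤ ∫ ω,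
      (((r + ε) * (4 * m) + 2 * K) - G.indicator (fun _ => (r + ε - a) * m) ω) ∂ν := by
    refine integral_mono_ae ?_ ((integrable_const _).sub hIind)
      (measure_mono_null (fun ω hω hmem => hω (hptw ω hmem)) hν)
    simpa using h.integrable_wordOf hν 0 (4 * m) F
  rw [integral_sub (integrable_const _) hIind, integral_indicator₀ hGm, setIntegral_const,
    integral_const, probReal_univ, one_smul, smul_eq_mul] at hmono
  have hra : 0 < r - a := by linarith
  have hGC : C * ((r - a) * m) ≤ ν.real G * ((r + ε - a) * m) := by
    have : C ≤ ν.real G := hUC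
    have h2 : (r - a) * m ≤ (r + ε - a) * m := by gcongr; linarith
    exact mul_le_mul this h2 (by positivity) (by positivity)
  have hCm : C * ((r - a) * m) = 16 * (ε * m) := by rw [hε]; ring
  have hlt : ∫ ω, F (wordOf ω (4 * m)) ∂ν < ((4 * m : ℕ) : ℝ) * (r - ε) := by
    push_cast
    have : 0 < ε * m := by positivity
    nlinarith
  obtain ⟨K', hK'⟩ := hF.exists_wordOf_le h.1 hu (by omega) hlt
  have := le_of_forall_wordOf_le hν hΛ hK'
  rw [EReal.coe_le_coe_iff] at this
  linarith

theorem SubadditiveOn.tendsto_div_length (hF : SubadditiveOn Ω F)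
    (h : IsMinimalSubshift Ω) [IsProbabilityMeasure ν] (hν : ν Ωᶜ = 0)
    (hinv : MeasurePreserving (shift 𝒜) ν ν) (hu : HasUniformUpperAverages Ω ν)
    {C : ℝ} (hC : 0 < C) {l : ℕ → ℕ} (hl : Tendsto l atTop atTop)
    (hB : ∀ n, ∀ w : List 𝒜, IsWordOf Ω w → w.length = l n → C ≤ (ν (Uset Ω w)).toReal)
    (hΛtop : Λ ≠ ⊤)
    (hΛ : ∀ᵐ ω ∂ν, Tendsto (fun n : ℕ => ((F (wordOf ω n) / (n : ℝ) : ℝ) : EReal))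
      atTop (nhds Λ)) {w : ℕ → List 𝒜}
    (hw : ∀ n, IsWordOf Ω (w n)) (hwl : ∀ n, (w n).length = l n) :
    Tendsto (fun n : ℕ => ((F (w n) / ((w n).length : ℝ) : ℝ) : EReal)) atTop (nhds Λ) := by
  refine tendsto_order.2 ⟨fun a ha => ?_, fun b hb => ?_⟩
  · obtain ⟨a', ha1, ha2⟩ := EReal.lt_iff_exists_real_btwn.1 ha
    lift Λ to ℝ using ⟨hΛtop, (bot_le.trans_lt ha2).ne'⟩
    filter_upwards [hF.eventually_lt h hν hinv hu hC hl hB hΛ (EReal.coe_lt_coe_iff.1 ha2) hw hwl]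
      with n hn
    exact ha1.trans (EReal.coe_lt_coe_iff.2 hn)
  · obtain ⟨b', hb1, hb2⟩ := EReal.lt_iff_exists_real_btwn.1 hb
    obtain ⟨c, hc1, hc2⟩ := EReal.lt_iff_exists_real_btwn.1 hb1
    rw [EReal.coe_lt_coe_iff] at hc2
    obtain ⟨n₀, hn₀, hint⟩ := hF.exists_integral_wordOf_lt h hν hΛ hc1
    obtain ⟨K, hK⟩ := hF.exists_wordOf_le h.1 hu hn₀ hint
    filter_upwards [hl.eventually_gt_atTop ⌈|K| / (b' - c)⌉₊] with n hn
    refine lt_trans (EReal.coe_lt_coe_iff.2 ?_) hb2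
    have hd : 0 < b' - c := by linarith
    have hm0 : (0 : ℝ) < l n := by exact_mod_cast (by omega : 0 < l n)
    have hKl : |K| < (b' - c) * l n := by
      rw [mul_comm, ← div_lt_iff₀ hd]
      exact (Nat.le_ceil _).trans_lt (by exact_mod_cast hn)
    obtain ⟨ω, hω, hωw⟩ := h.1.exists_wordOf_eq (hw n)
    have h1 := hK (w n).length ω hω
    rw [hωw] at h1
    rw [hwl] at h1 ⊢
    rw [div_lt_iff₀ hm0]
    have := le_abs_self K
    linarith

end SubadditiveLimit

section Covering

variable {𝒜 : Type*}

/-- The position `i` of the word `x` lies inside an occurrence in `x` of one of the words `v k`. -/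
def IsCovered (v : ℕ → List 𝒜) (x : List 𝒜) (i : ℕ) : Prop :=
  ∃ k p s, x = p ++ v k ++ s ∧ p.length ≤ i ∧ i < p.length + (v k).length

/-- The sequences for which `v` occurs around position one. -/
def occursAround (v : List 𝒜) : Set (ℤ → 𝒜) :=
  {ω | ∃ t < v.length, wordOf (ztranslate (-(t : ℤ)) ω) v.length = v}

open Classical in
/-- The number of positions of `x` covered by occurrences of the words `v k`. -/
noncomputable def coveredCount (v : ℕ → List 𝒜) (x : List 𝒜) : ℝ :=
  ∑ i ∈ Finset.range x.length, if IsCovered v x i then 1 else 0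

theorem coveredCount_add_le (v : ℕ → List 𝒜) (x y : List 𝒜) :
    coveredCount v x + coveredCount v y ≤ coveredCount v (x ++ y) := by
  classical
  unfold coveredCount
  rw [List.length_append, Finset.sum_range_add]
  refine add_le_add (Finset.sum_le_sum fun i _ => ?_) (Finset.sum_le_sum fun i _ => ?_)
  · by_cases hi : IsCovered v x i
    · have : IsCovered v (x ++ y) i := by
        obtain ⟨k, p, s, rfl, h1, h2⟩ := hi
        exact ⟨k, p, s ++ y, by simp, h1, h2⟩
      simp [hi, this]
    · rw [if_neg hi]; split_ifs <;> norm_num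
  · by_cases hi : IsCovered v y i
    · have : IsCovered v (x ++ y) (x.length + i) := by
        obtain ⟨k, p, s, rfl, h1, h2⟩ := hi
        exact ⟨k, x ++ p, s, by simp, by simpa using h1, by simp; omega⟩
      simp [hi, this]
    · rw [if_neg hi]; split_ifs <;> norm_num

theorem coveredCount_self (v : ℕ → List 𝒜) (k : ℕ) :
    coveredCount v (v k) = (v k).length := by
  classical
  unfold coveredCount
  rw [Finset.sum_congr rfl fun i hi => if_pos (c := IsCovered v (v k) i)
    ⟨k, [], [], by simp, by simp, by simpa using hi⟩]
  simp

theorem IsCovered.exists_mem_occursAround {v : ℕ → List 𝒜} {ω : ℤ → 𝒜} {n i : ℕ}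
    (hi : IsCovered v (wordOf ω n) i) : ztranslate (i : ℤ) ω ∈ ⋃ k, occursAround (v k) := by
  obtain ⟨k, p, s, h, h1, h2⟩ := hi
  refine mem_iUnion.2 ⟨k, i - p.length, by omega, ?_⟩
  rw [ztranslate_ztranslate, show (i : ℤ) + -((i - p.length : ℕ) : ℤ) = p.length by omega]
  have hn : n = p.length + (v k).length + s.length := by
    simpa [add_assoc] using congrArg List.length h
  rw [hn, wordOf_add, wordOf_add] at h
  have h3 := (List.append_inj' h (by simp)).1
  exact (List.append_inj' h3 (by simp)).2

theorem isCovered_of_mem_occursAround {v : ℕ → List 𝒜} {ω : ℤ → 𝒜} {n i k R : ℕ}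
    (hR : (v k).length ≤ R) (hi : R ≤ i) (hn : i + R ≤ n)
    (h : ztranslate (i : ℤ) ω ∈ occursAround (v k)) : IsCovered v (wordOf ω n) i := by
  obtain ⟨t, ht, h⟩ := h
  rw [ztranslate_ztranslate, show (i : ℤ) + -(t : ℤ) = ((i - t : ℕ) : ℤ) by omega] at h
  obtain ⟨s, rfl⟩ := Nat.exists_eq_add_of_le (show (i - t) + (v k).length ≤ n by omega)
  refine ⟨k, wordOf ω (i - t), wordOf (ztranslate ((i - t + (v k).length : ℕ) : ℤ) ω) s, ?_,
    by simp, by simp; omega⟩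
  rw [wordOf_add, wordOf_add, h]

theorem coveredCount_wordOf_le (v : ℕ → List 𝒜) (ω : ℤ → 𝒜) (n : ℕ) :
    coveredCount v (wordOf ω n)
      ≤ birkhoffSum (shift 𝒜) ((⋃ k, occursAround (v k)).indicator fun _ => (1 : ℝ)) n ω := by
  classical
  unfold coveredCount birkhoffSum
  rw [length_wordOf]
  refine Finset.sum_le_sum fun i _ => ?_
  rw [shift_iterate]
  split_ifs with h
  · rw [indicator_of_mem h.exists_mem_occursAround]
  · exact indicator_nonneg (fun _ _ => zero_le_one) _

theorem le_coveredCount_wordOf {v : ℕ → List 𝒜} {K R : ℕ} (hR : ∀ k ≤ K, (v k).length ≤ R)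
    (ω : ℤ → 𝒜) (n : ℕ) :
    birkhoffSum (shift 𝒜) ((accumulate (fun k => occursAround (v k)) K).indicator
      fun _ => (1 : ℝ)) n ω ≤ coveredCount v (wordOf ω n) + 2 * R := by
  classical
  have h1 : ∑ i ∈ Finset.range n, (if i < R then (1 : ℝ) else 0) ≤ R := by
    rw [Finset.sum_boole]
    have : ({i ∈ Finset.range n | i < R} : Finset ℕ) ⊆ Finset.range R := fun i hi => by
      simp at hi ⊢; exact hi.2
    exact_mod_cast (Finset.card_le_card this).trans (by simp)
  have h2 : ∑ i ∈ Finset.range n, (if n < i + R then (1 : ℝ) else 0) ≤ R := by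
    rw [Finset.sum_boole]
    have : ({i ∈ Finset.range n | n < i + R} : Finset ℕ) ⊆ Finset.Ico (n - R) n := fun i hi => by
      simp at hi ⊢; omega
    exact_mod_cast (Finset.card_le_card this).trans (by rw [Nat.card_Ico]; omega)
  have h3 : birkhoffSum (shift 𝒜) ((accumulate (fun k => occursAround (v k)) K).indicator
      fun _ => (1 : ℝ)) n ω ≤ ∑ i ∈ Finset.range n, ((if IsCovered v (wordOf ω n) i then 1 else 0)
        + (if i < R then (1 : ℝ) else 0) + (if n < i + R then (1 : ℝ) else 0)) := by
    refine Finset.sum_le_sum fun i _ => ?_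
    rw [shift_iterate]
    by_cases hi : ztranslate (i : ℤ) ω ∈ accumulate (fun k => occursAround (v k)) K
    · rw [indicator_of_mem hi]
      obtain ⟨k, hk, hmem⟩ := mem_accumulate.1 hi
      by_cases hiR : i < R
      · rw [if_pos hiR]
        split_ifs <;> norm_num
      · by_cases hin : n < i + R
        · rw [if_pos hin]; split_ifs <;> norm_num
        · rw [if_pos (isCovered_of_mem_occursAround (hR k hk) (by omega) (by omega) hmem)]
          split_ifs; norm_num
    · rw [indicator_of_notMem hi]
      split_ifs <;> norm_num
  rw [Finset.sum_add_distrib, Finset.sum_add_distrib] at h3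
  unfold coveredCount
  rw [length_wordOf]
  linarith

end Covering

section UniformityToBoshernitzan

variable {𝒜 : Type*} [Fintype 𝒜] [TopologicalSpace 𝒜] [DiscreteTopology 𝒜] [MeasurableSpace 𝒜]
  {Ω : Set (ℤ → 𝒜)} {ν : Measure (ℤ → 𝒜)}

theorem IsMinimalSubshift.nullMeasurableSet_occursAround (h : IsMinimalSubshift Ω)
    [IsProbabilityMeasure ν] (hν : ν Ωᶜ = 0) (v : List 𝒜) :
    NullMeasurableSet (occursAround v) ν := by
  have : occursAround v = ⋃ t ∈ Finset.range v.length,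
      {ω : ℤ → 𝒜 | wordOf (ztranslate (-(t : ℤ)) ω) v.length ∈ ({v} : Set _)} := by
    ext ω; simp [occursAround]
  rw [this]
  exact Finset.nullMeasurableSet_biUnion _ fun t _ => h.nullMeasurableSet_wordOf hν _ _ {v}

theorem measure_occursAround {𝒜 : Type*} [MeasurableSpace 𝒜] {Ω : Set (ℤ → 𝒜)}
    {ν : Measure (ℤ → 𝒜)} (hν : ν Ωᶜ = 0) (v : List 𝒜) :
    ν (occursAround v) = ν (Uset Ω v) := by
  rw [← measure_inter_conull (s := occursAround v) hν]
  congr 1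
  ext ω
  have : ∀ t : ℕ, (1 : ℤ) - t - 1 = -t := fun t => by ring
  simp [Uset, occursAt_iff, occursAround, and_comm, this]

theorem Ergodic.ae_tendsto_birkhoffSum_indicator {X : Type*} [MeasurableSpace X] {T : X → X}
    {μ : Measure X} [IsProbabilityMeasure μ] (hT : Ergodic T μ) {s : Set X}
    (hs : NullMeasurableSet s μ) :
    ∀ᵐ x ∂μ, Tendsto (fun n : ℕ => birkhoffSum T (s.indicator fun _ => (1 : ℝ)) n x / n) atTop
      (nhds (μ.real s)) := by
  have h1 := hT.ae_tendsto_birkhoffSum_div (f := s.indicator fun _ => (1 : ℝ)) (D := 1)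
    (aemeasurable_const.indicator₀ hs) (fun x => by
      by_cases hx : x ∈ s <;> simp [hx])
  rwa [integral_indicator₀ hs, setIntegral_const, smul_eq_mul, mul_one] at h1

theorem IsMinimalSubshift.ae_tendsto_coveredCount (h : IsMinimalSubshift Ω)
    [IsProbabilityMeasure ν] (hν : ν Ωᶜ = 0) (herg : Ergodic (shift 𝒜) ν) (v : ℕ → List 𝒜) :
    ∀ᵐ ω ∂ν, Tendsto (fun n : ℕ => coveredCount v (wordOf ω n) / n) atTop
      (nhds (ν.real (⋃ k, occursAround (v k)))) := by
  have hm : ∀ k, NullMeasurableSet (occursAround (v k)) ν := fun k =>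
    h.nullMeasurableSet_occursAround hν (v k)
  have hacc : ∀ K, NullMeasurableSet (accumulate (fun k => occursAround (v k)) K) ν := fun K => by
    rw [accumulate_def]
    exact NullMeasurableSet.iUnion fun k => NullMeasurableSet.iUnion fun _ => hm k
  have h1 := herg.ae_tendsto_birkhoffSum_indicator (NullMeasurableSet.iUnion hm)
  have h2 := ae_all_iff.2 fun K => herg.ae_tendsto_birkhoffSum_indicator (hacc K)
  have hlim : Tendsto (fun K => ν.real (accumulate (fun k => occursAround (v k)) K)) atTop
      (nhds (ν.real (⋃ k, occursAround (v k)))) :=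
    (ENNReal.tendsto_toReal (measure_ne_top _ _)).comp tendsto_measure_iUnion_accumulate
  filter_upwards [h1, h2] with ω hω1 hω2
  refine tendsto_order.2 ⟨fun a ha => ?_, fun b hb => ?_⟩
  · obtain ⟨K, hK⟩ := (hlim.eventually_const_lt ha).exists
    obtain ⟨R, hR⟩ : ∃ R, ∀ k ≤ K, (v k).length ≤ R :=
      ⟨(Finset.range (K + 1)).sup fun k => (v k).length, fun k hk =>
        Finset.le_sup (f := fun k => (v k).length) (Finset.mem_range.2 (by omega))⟩
    have h3 := (hω2 K).sub (tendsto_const_div_atTop_nhds_zero_nat (2 * (R : ℝ)))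
    rw [sub_zero] at h3
    filter_upwards [h3.eventually_const_lt hK] with n hn
    refine hn.trans_le ?_
    rw [← sub_div]
    have := le_coveredCount_wordOf hR ω n
    gcongr
    linarith
  · filter_upwards [hω1.eventually_lt_const hb] with n hn
    refine lt_of_le_of_lt ?_ hn
    gcongr
    exact coveredCount_wordOf_le v ω n

theorem ergodic_of_forall_eq {X : Type*} [MeasurableSpace X] {T : X → X} {Y : Set X}
    {μ : Measure X} [IsProbabilityMeasure μ] (hY : μ Yᶜ = 0) (hT : MeasurePreserving T μ μ)
    (huniq : ∀ ρ : Measure X, IsProbabilityMeasure ρ → ρ Yᶜ = 0 → MeasurePreserving T ρ ρ → ρ = μ) :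
    Ergodic T μ := by
  refine ⟨hT, ⟨fun s hs hinv => ?_⟩⟩
  rw [eventuallyConst_set']
  by_cases h0 : μ s = 0
  · exact Or.inl (ae_eq_empty.2 h0)
  · right
    have hp : IsProbabilityMeasure (ProbabilityTheory.cond μ s) :=
      ProbabilityTheory.cond_isProbabilityMeasure h0
    have hpres : MeasurePreserving T (ProbabilityTheory.cond μ s)
        (ProbabilityTheory.cond μ s) := by
      have := hT.restrict_preimage hs
      rw [hinv] at this
      exact this.smul_measure _
    have heq := huniq _ hp (ProbabilityTheory.cond_absolutelyContinuous hY) hpres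
    have hmem := ProbabilityTheory.ae_cond_mem (μ := μ) hs
    rw [heq] at hmem
    exact eventuallyEq_univ.2 hmem

/-- If the averages of all subadditive functions converge along the words of length `l n`, then
the sets `U_w` cannot be small for all large `n`. -/
theorem IsMinimalSubshift.exists_frequently_le_measure_Uset (h : IsMinimalSubshift Ω)
    [IsProbabilityMeasure ν] (hν : ν Ωᶜ = 0) (herg : Ergodic (shift 𝒜) ν) {l : ℕ → ℕ}
    (hl : Tendsto l atTop atTop)
    (hF : ∀ F : List 𝒜 → ℝ, SubadditiveOn Ω F → ∀ Λ : EReal, Λ ≠ ⊤ →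
      (∀ᵐ ω ∂ν, Tendsto (fun n : ℕ => ((F (wordOf ω n) / (n : ℝ) : ℝ) : EReal))
        atTop (nhds Λ)) →
      ∀ w : ℕ → List 𝒜, (∀ n, IsWordOf Ω (w n)) → (∀ n, (w n).length = l n) →
        Tendsto (fun n : ℕ => ((F (w n) / ((w n).length : ℝ) : ℝ) : EReal)) atTop (nhds Λ)) :
    ∃ C > (0 : ENNReal), ∃ᶠ n in atTop, ∀ w : List 𝒜, IsWordOf Ω w → w.length = l n →
      C ≤ ν (Uset Ω w) := by
  by_contra! hcon
  obtain ⟨δ, hδ0, hδ⟩ := ENNReal.exists_pos_sum_of_countable' (one_ne_zero (α := ENNReal)) ℕ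
  have hev : ∀ k, ∀ᶠ n in atTop, 0 < l n ∧ ∃ w : List 𝒜, IsWordOf Ω w ∧ w.length = l n ∧
      ν (Uset Ω w) < δ k := fun k =>
    (hl.eventually_gt_atTop 0).and (hcon (δ k) (hδ0 k))
  obtain ⟨φ, hφ, hφk⟩ := extraction_forall_of_eventually hev
  have hmem : ∀ᵐ ω ∂ν, ω ∈ Ω := hν
  obtain ⟨ω₀, hω₀⟩ := hmem.exists
  have hwex : ∀ n, ∃ w : List 𝒜, IsWordOf Ω w ∧ w.length = l n ∧
      ∀ k, φ k = n → ν (Uset Ω w) < δ k := by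
    intro n
    by_cases hn : ∃ k, φ k = n
    · obtain ⟨k, rfl⟩ := hn
      obtain ⟨-, w, hw1, hw2, hw3⟩ := hφk k
      exact ⟨w, hw1, hw2, fun k' hk' => by rwa [hφ.injective hk']⟩
    · exact ⟨wordOf ω₀ (l n), isWordOf_wordOf hω₀ _, length_wordOf _ _,
        fun k hk => absurd ⟨k, hk⟩ hn⟩
  choose w hw hwl hwU using hwex
  set v : ℕ → List 𝒜 := fun k => w (φ k) with hv
  set U : Set (ℤ → 𝒜) := ⋃ k, occursAround (v k) with hU
  have hUlt : ν U < 1 := by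
    refine lt_of_le_of_lt (measure_iUnion_le _) (lt_of_le_of_lt (ENNReal.tsum_le_tsum fun k => ?_) hδ)
    rw [measure_occursAround hν]
    exact (hwU _ k rfl).le
  have hsub : SubadditiveOn Ω fun x => - coveredCount v x := fun x y _ _ _ => by
    have := coveredCount_add_le v x y
    linarith
  have hlim := hF _ hsub ((- ν.real U : ℝ) : EReal) (EReal.coe_ne_top _) (by
    filter_upwards [h.ae_tendsto_coveredCount hν herg v] with ω hω
    have h1 := (continuous_coe_real_ereal.tendsto _).comp hω.neg
    refine h1.congr fun n => ?_
    simp [neg_div]) w hw hwl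
  have hone : ∀ k, - coveredCount v (w (φ k)) / ((w (φ k)).length : ℝ) = -1 := fun k => by
    have h1 : ((v k).length : ℝ) ≠ 0 := by
      have h2 : (v k).length = l (φ k) := hwl _
      have := (hφk k).1
      rw [h2]
      exact_mod_cast this.ne'
    have := coveredCount_self v k
    change - coveredCount v (v k) / ((v k).length : ℝ) = -1
    rw [this, neg_div, div_self h1]
  have hconst : Tendsto (fun _ : ℕ => ((-1 : ℝ) : EReal)) atTop
      (nhds ((- ν.real U : ℝ) : EReal)) :=
    (hlim.comp hφ.tendsto_atTop).congr fun k => by simp only [Function.comp_apply, hone]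
  have heq := tendsto_nhds_unique hconst tendsto_const_nhds
  rw [EReal.coe_eq_coe_iff, neg_inj] at heq
  have : ν.real U < 1 := by
    rw [measureReal_def, ← ENNReal.toReal_one]
    exact ENNReal.toReal_strict_mono ENNReal.one_ne_top hUlt
  linarith

end UniformityToBoshernitzan

/-- the characterization of (B): (i) ⇔ (ii) ⇔ (iii). -/
theorem stmt7 {𝒜 : Type*} [Fintype 𝒜] [TopologicalSpace 𝒜] [DiscreteTopology 𝒜]
    [MeasurableSpace 𝒜] (Ω : Set (ℤ → 𝒜)) (hmin : IsMinimalSubshift Ω) :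
    (CondB Ω ↔ CondB' Ω) ∧
    (CondB Ω ↔
      (UniquelyErgodicSubshift Ω ∧
        ∃ l : ℕ → ℕ, Tendsto l atTop atTop ∧
          ∀ F : List 𝒜 → ℝ, SubadditiveOn Ω F →
            ∀ μ : Measure (ℤ → 𝒜), IsProbabilityMeasure μ → μ Ωᶜ = 0 →
              MeasurePreserving (shift 𝒜) μ μ →
            ∀ Λ : EReal, Λ ≠ ⊤ →
              (∀ᵐ ω ∂μ, Tendsto (fun n : ℕ => ((F (wordOf ω n) / (n : ℝ) : ℝ) : EReal))
                atTop (nhds Λ)) →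
              ∀ w : ℕ → List 𝒜, (∀ n, IsWordOf Ω (w n)) → (∀ n, (w n).length = l n) →
                Tendsto (fun n : ℕ => ((F (w n) / ((w n).length : ℝ) : ℝ) : EReal))
                  atTop (nhds Λ))) := by
  have hBwords : ∀ {ν : Measure (ℤ → 𝒜)} {C : ℝ} {l : ℕ → ℕ}, ν Ωᶜ = 0 →
      (∀ n, ∀ w : List 𝒜, IsWordOf Ω w → w.length = l n →
        C ≤ (w.length : ℝ) * (ν (Vset Ω w)).toReal) →
      ∀ n, ∀ w : List 𝒜, IsWordOf Ω w → w.length = l n →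
        C ≤ l n * ν.real {ω | wordOf ω (l n) = w} := by
    intro ν C l hν hB n w hw hwl
    have := hB n w hw hwl
    rwa [measure_Vset hν, hwl] at this
  have hBU : ∀ {ν : Measure (ℤ → 𝒜)} {C : ℝ} {l : ℕ → ℕ}, IsProbabilityMeasure ν → ν Ωᶜ = 0 →
      MeasurePreserving (shift 𝒜) ν ν → 0 < C →
      (∀ n, ∀ w : List 𝒜, IsWordOf Ω w → w.length = l n →
        C ≤ (w.length : ℝ) * (ν (Vset Ω w)).toReal) →
      ∀ n, ∀ w : List 𝒜, IsWordOf Ω w → w.length = l n / 2 + 1 →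
        min (C / 2) 1 ≤ (ν (Uset Ω w)).toReal := by
    intro ν C l hp hν hinv hC hB n w hw hwl
    refine hmin.le_measure_Uset hν hinv hC ?_ (hBwords hν hB n) hw hwl
    obtain ⟨ω, hω, -⟩ := hw
    have := hBwords hν hB n _ (isWordOf_wordOf hω (l n)) (length_wordOf _ _)
    rcases Nat.eq_zero_or_pos (l n) with h0 | h0
    · rw [h0] at this
      simp at this
      linarith
    · exact h0
  have hhalf : ∀ {l : ℕ → ℕ}, Tendsto l atTop atTop →
      Tendsto (fun n => l n / 2 + 1) atTop atTop := fun hl =>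
    (tendsto_add_atTop_nat 1).comp ((Nat.tendsto_div_const_atTop two_ne_zero).comp hl)
  have hBB' : CondB Ω → CondB' Ω := by
    rintro ⟨ν, hp, hν, herg, C, hC, l, hl, hB⟩
    exact ⟨ν, hp, hν, herg, min (C / 2) 1, lt_min (half_pos hC) one_pos, _, hhalf hl,
      hBU hp hν herg.toMeasurePreserving hC hB⟩
  have hB'B : CondB' Ω → CondB Ω := by
    rintro ⟨ν, hp, hν, herg, C, hC, l, hl, hB⟩
    exact ⟨ν, hp, hν, herg, C, hC, l, hl, fun n w hw hwl => (hB n w hw hwl).trans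
      (hmin.measure_Uset_le hν herg.toMeasurePreserving w)⟩
  refine ⟨⟨hBB', hB'B⟩, ?_, ?_⟩
  · rintro ⟨ν, hp, hν, herg, C, hC, l, hl, hB⟩
    have hinv := herg.toMeasurePreserving
    have hu := hmin.hasUniformUpperAverages hν herg hC hl (hBwords hν hB)
    have huniq : ∀ μ : Measure (ℤ → 𝒜), IsProbabilityMeasure μ → μ Ωᶜ = 0 →
        MeasurePreserving (shift 𝒜) μ μ → μ = ν := fun μ _ hμ hμinv =>
      hmin.eq_of_hasUniformUpperAverages hν hinv hu hμ hμinv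
    refine ⟨⟨ν, ⟨hp, hν, hinv⟩, fun μ ⟨h1, h2, h3⟩ => huniq μ h1 h2 h3⟩, _, hhalf hl, ?_⟩
    intro F hF μ hμp hμ hμinv Λ hΛtop hΛ w hw hwl
    obtain rfl := huniq μ hμp hμ hμinv
    exact hF.tendsto_div_length hmin hν hinv hu (lt_min (half_pos hC) one_pos) (hhalf hl)
      (hBU hp hν hinv hC hB) hΛtop hΛ hw hwl
  · rintro ⟨⟨ν, ⟨hp, hν, hinv⟩, huniq⟩, l, hl, hF⟩
    have herg : Ergodic (shift 𝒜) ν :=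
      ergodic_of_forall_eq hν hinv fun ρ h1 h2 h3 => huniq ρ ⟨h1, h2, h3⟩
    obtain ⟨C, hC, hfreq⟩ := hmin.exists_frequently_le_measure_Uset hν herg hl
      fun F hFsub => hF F hFsub ν hp hν hinv
    obtain ⟨φ, hφ, hφC⟩ := extraction_of_frequently_atTop hfreq
    refine hB'B ⟨ν, hp, hν, herg, (min C 1).toReal, ?_, _, hl.comp hφ.tendsto_atTop,
      fun n w hw hwl => ?_⟩
    · exact ENNReal.toReal_pos (lt_min hC one_pos).ne' (min_lt_of_right_lt ENNReal.one_lt_top).ne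
    · exact ENNReal.toReal_mono (measure_ne_top _ _)
        ((min_le_left _ _).trans (hφC n w hw hwl))
end

section
/- Let (Ω,T) be a minimal uniquely ergodic subshift over a finite alphabet 𝒜 that satisfies property (P), and let S : 𝒜 → ℬ* be a substitution (each S(a) a nonempty word over a finite alphabet ℬ). Then the subshift (Ω(S),T) satisfies property (P) as well. -/
open Filter MeasureTheory Set

section LogNorm

/-- The logarithm of the norm of an element of `SL(2,ℝ)`. -/
noncomputable def logNorm (g : SL2) : ℝ :=
  Real.log (matNorm (g : Matrix (Fin 2) (Fin 2) ℝ))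

theorem one_le_matNorm (g : SL2) : 1 ≤ matNorm (g : Matrix (Fin 2) (Fin 2) ℝ) := by
  have h := g.det_coe
  rw [Matrix.det_fin_two] at h
  rw [matNorm, Real.one_le_sqrt]
  simp only [Fin.sum_univ_two]
  nlinarith [sq_nonneg (g 0 0 - g 1 1), sq_nonneg (g 0 1 + g 1 0)]

theorem matNorm_mul_le (M N : Matrix (Fin 2) (Fin 2) ℝ) :
    matNorm (M * N) ≤ matNorm M * matNorm N := by
  rw [matNorm, matNorm, matNorm, ← Real.sqrt_mul (by positivity)]
  apply Real.sqrt_le_sqrt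
  simp only [Matrix.mul_apply, Fin.sum_univ_two]
  nlinarith [sq_nonneg (M 0 0 * N 1 0 - M 0 1 * N 0 0), sq_nonneg (M 0 0 * N 1 1 - M 0 1 * N 0 1),
    sq_nonneg (M 1 0 * N 1 0 - M 1 1 * N 0 0), sq_nonneg (M 1 0 * N 1 1 - M 1 1 * N 0 1)]

theorem logNorm_nonneg (g : SL2) : 0 ≤ logNorm g :=
  Real.log_nonneg (one_le_matNorm g)

theorem logNorm_mul_le (g h : SL2) : logNorm (g * h) ≤ logNorm g + logNorm h := by
  have hg := one_le_matNorm g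
  have hh := one_le_matNorm h
  have hgh := one_le_matNorm (g * h)
  rw [logNorm, logNorm, logNorm, ← Real.log_mul (by positivity) (by positivity)]
  apply Real.log_le_log (by positivity)
  rw [Matrix.SpecialLinearGroup.coe_mul]
  exact matNorm_mul_le _ _

theorem logNorm_inv (g : SL2) : logNorm g⁻¹ = logNorm g := by
  rw [logNorm, logNorm, matNorm, matNorm, Matrix.SpecialLinearGroup.coe_inv,
    Matrix.adjugate_fin_two]
  simp only [Fin.sum_univ_two, Matrix.of_apply, Matrix.cons_val_zero, Matrix.cons_val_one,
    Matrix.cons_val', Matrix.cons_val_fin_one]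
  congr 2
  ring

/-- Multiplying two elements by bounded factors changes `logNorm` by a bounded amount. -/
theorem abs_logNorm_sub_le_of_mul_eq {x y u v : SL2} (h : x * u = v * y) :
    |logNorm x - logNorm y| ≤ logNorm u + logNorm v := by
  have hx : x = v * y * u⁻¹ := by rw [← h]; group
  have hy : y = v⁻¹ * x * u := by rw [mul_assoc, h]; group
  have h1 := logNorm_mul_le (v * y) u⁻¹
  have h2 := logNorm_mul_le v y
  have h3 := logNorm_mul_le (v⁻¹ * x) u
  have h4 := logNorm_mul_le v⁻¹ x
  rw [← hx] at h1
  rw [← hy] at h3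
  rw [logNorm_inv] at h1 h4
  rw [abs_le]
  constructor <;> linarith

/-- The diagonal matrix with entries `exp t` and `exp (-t)`. -/
noncomputable def diagExp (t : ℝ) : SL2 :=
  ⟨!![Real.exp t, 0; 0, Real.exp (-t)], by
    rw [Matrix.det_fin_two_of, ← Real.exp_add]; simp⟩

theorem diagExp_zero : diagExp 0 = 1 := by
  ext i j
  fin_cases i <;> fin_cases j <;> simp [diagExp]

theorem diagExp_add (s t : ℝ) : diagExp (s + t) = diagExp s * diagExp t := by
  ext i j
  rw [Matrix.SpecialLinearGroup.coe_mul]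
  fin_cases i <;> fin_cases j <;>
    simp [diagExp, Real.exp_add, mul_comm]

theorem abs_logNorm_diagExp_sub_le {t : ℝ} (ht : 0 ≤ t) : |logNorm (diagExp t) - t| ≤ 1 := by
  have hsum : matNorm (diagExp t : Matrix (Fin 2) (Fin 2) ℝ) =
      Real.sqrt (Real.exp t ^ 2 + Real.exp (-t) ^ 2) := by
    simp [matNorm, diagExp, Fin.sum_univ_two]
  have hpos := Real.exp_pos t
  have hneg := Real.exp_pos (-t)
  have hle : Real.exp (-t) ≤ Real.exp t := Real.exp_le_exp.mpr (by linarith)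
  have h2 : (2 : ℝ) ≤ Real.exp 1 := by linarith [Real.add_one_le_exp (1 : ℝ)]
  have hlow : Real.exp t ≤ Real.sqrt (Real.exp t ^ 2 + Real.exp (-t) ^ 2) :=
    Real.le_sqrt_of_sq_le (by nlinarith)
  have hup : Real.sqrt (Real.exp t ^ 2 + Real.exp (-t) ^ 2) ≤ Real.exp (t + 1) := by
    rw [Real.exp_add, Real.sqrt_le_left (by positivity)]
    have : (2 * Real.exp t) ^ 2 ≤ (Real.exp t * Real.exp 1) ^ 2 := by
      gcongr ?_ ^ 2
      nlinarith
    nlinarith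
  rw [abs_le, logNorm, hsum]
  have h3 := Real.log_le_log hpos hlow
  have h4 := Real.log_le_log (hpos.trans_le hlow) hup
  rw [Real.log_exp] at h3 h4
  constructor <;> linarith

end LogNorm

section Shift

theorem shift_iterate_s10 {𝒜 : Type*} (n : ℕ) (ω : ℤ → 𝒜) :
    (shift 𝒜)^[n] ω = fun m => ω (m + n) := by
  induction n with
  | zero => simp
  | succ n ih =>
    rw [Function.iterate_succ_apply', ih]
    funext m
    simp only [shift]
    congr 1
    push_cast
    ring

theorem cocycle_add {𝒜 G : Type*} [Monoid G] (A : (ℤ → 𝒜) → G) (m n : ℕ) (ω : ℤ → 𝒜) :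
    cocycle A (m + n) ω = cocycle A m ((shift 𝒜)^[n] ω) * cocycle A n ω := by
  induction m with
  | zero => simp [cocycle]
  | succ m ih =>
    rw [Nat.succ_add, cocycle, cocycle, ih, ← Function.iterate_add_apply, mul_assoc]

theorem IsSubshift.translate_mem_s10 {𝒜 : Type*} [TopologicalSpace 𝒜] {Ω : Set (ℤ → 𝒜)}
    (h : IsSubshift Ω) {ω : ℤ → 𝒜} (hω : ω ∈ Ω) (k : ℤ) : (fun n => ω (n + k)) ∈ Ω := by
  induction k with
  | zero => simpa using hω
  | succ k ih =>
    have := Set.mem_image_of_mem (shift 𝒜) ih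
    rw [h.2] at this
    convert this using 1
    funext n
    simp only [shift]
    congr 1
    ring
  | pred k ih =>
    rw [← h.2] at ih
    obtain ⟨ρ, hρ, hρe⟩ := ih
    convert hρ using 1
    funext n
    have := congrFun hρe (n - 1)
    simp only [shift, sub_add_cancel] at this
    rw [this]
    congr 1
    ring

/-- Up to time `j`, the cocycle of a locally constant function depends on a window of size `j`
more than the function itself. -/
theorem cocycle_congr {𝒜 G : Type*} [Monoid G] {Y : Set (ℤ → 𝒜)} {A : (ℤ → 𝒜) → G} {N : ℕ}
    (hY : ∀ ω ∈ Y, ∀ k : ℤ, (fun n => ω (n + k)) ∈ Y)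
    (hA : ∀ ω ∈ Y, ∀ ρ ∈ Y, (∀ i : ℤ, |i| ≤ (N : ℤ) → ω i = ρ i) → A ω = A ρ)
    {ω ρ : ℤ → 𝒜} (hω : ω ∈ Y) (hρ : ρ ∈ Y) (j : ℕ)
    (h : ∀ i : ℤ, |i| ≤ ((N + j : ℕ) : ℤ) → ω i = ρ i) : cocycle A j ω = cocycle A j ρ := by
  induction j with
  | zero => rfl
  | succ j ih =>
    rw [cocycle, cocycle, ih fun i hi => h i (by push_cast at hi ⊢; omega), shift_iterate_s10,
      shift_iterate_s10]
    congr 1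
    refine hA _ (hY ω hω j) _ (hY ρ hρ j) fun i hi => h _ ?_
    rw [abs_le] at hi ⊢
    push_cast
    omega

theorem LocConstOn.finite_image {𝒜 β : Type*} [Finite 𝒜] {Y : Set (ℤ → 𝒜)}
    {A : (ℤ → 𝒜) → β} (hA : LocConstOn Y A) : (A '' Y).Finite := by
  obtain ⟨N, hN⟩ := hA
  let r : Y → (Set.Icc (-(N : ℤ)) N → 𝒜) := fun ω i => ω.1 i
  have hfac : Function.FactorsThrough (fun ω : Y => A ω) r := by
    intro ω ρ h
    refine hN _ ω.2 _ ρ.2 fun i hi => ?_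
    exact congrFun h ⟨i, abs_le.mp hi⟩
  have : (Set.range fun ω : Y => A ω).Finite := by
    rcases isEmpty_or_nonempty Y with hY | ⟨⟨ω₀⟩⟩
    · exact Set.finite_range _
    · rw [← hfac.extend_comp (fun _ => A ω₀)]
      exact (Set.finite_range _).subset (Set.range_comp_subset_range _ _)
  rwa [Set.image_eq_range]

theorem exists_logNorm_cocycle_le {𝒜 : Type*} [Finite 𝒜] {Y : Set (ℤ → 𝒜)}
    {A : (ℤ → 𝒜) → SL2} (hY : ∀ ω ∈ Y, ∀ k : ℤ, (fun n => ω (n + k)) ∈ Y)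
    (hA : LocConstOn Y A) (L : ℕ) :
    ∃ K : ℝ, 0 ≤ K ∧ ∀ ω ∈ Y, ∀ j ≤ L, logNorm (cocycle A j ω) ≤ K := by
  obtain ⟨K, hK⟩ := (hA.finite_image.image logNorm).bddAbove
  have h1 : 0 ≤ logNorm (1 : SL2) := logNorm_nonneg _
  have hbound : ∀ ω ∈ Y, ∀ j : ℕ, logNorm (cocycle A j ω) ≤ logNorm 1 + j * |K| := by
    intro ω hω j
    induction j with
    | zero => simp [cocycle]
    | succ j ih =>
      have h2 := logNorm_mul_le (A ((shift 𝒜)^[j] ω)) (cocycle A j ω)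
      have h3 : logNorm (A ((shift 𝒜)^[j] ω)) ≤ K := by
        refine hK (Set.mem_image_of_mem _ (Set.mem_image_of_mem _ ?_))
        rw [shift_iterate_s10]
        exact hY ω hω j
      rw [cocycle]
      push_cast
      linarith [le_abs_self K]
  refine ⟨logNorm 1 + L * |K|, by positivity, fun ω hω j hj => (hbound ω hω j).trans ?_⟩
  gcongr

end Shift

section SubstImage

variable {𝒜 ℬ : Type*} {S : 𝒜 → List ℬ}

/-- `c` lists the starting positions of the blocks `S (ω k)` in the image of `ω`. -/
def IsCut (S : 𝒜 → List ℬ) (ω : ℤ → 𝒜) (c : ℤ → ℤ) : Prop :=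
  c 0 = 0 ∧ ∀ k : ℤ, c (k + 1) = c k + (S (ω k)).length

/-- `σ` is made of the blocks `S (ω k)` starting at the positions `c k`. -/
def HasBlocks (S : 𝒜 → List ℬ) (ω : ℤ → 𝒜) (c : ℤ → ℤ) (σ : ℤ → ℬ) : Prop :=
  ∀ k : ℤ, ∀ j : Fin (S (ω k)).length, σ (c k + j) = (S (ω k)).get j

theorem exists_isCut (S : 𝒜 → List ℬ) (ω : ℤ → 𝒜) : ∃ c, IsCut S ω c := by
  refine ⟨fun k => ∑ i ∈ Finset.range k.toNat, ((S (ω i)).length : ℤ) -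
    ∑ i ∈ Finset.range (-k).toNat, ((S (ω (-(i : ℤ) - 1))).length : ℤ), by simp, fun k => ?_⟩
  rcases le_or_gt 0 k with hk | hk
  · lift k to ℕ using hk
    have h1 : ((k : ℤ) + 1).toNat = k + 1 := by omega
    have h2 : (-((k : ℤ) + 1)).toNat = 0 := by omega
    have h3 : (-(k : ℤ)).toNat = 0 := by omega
    have h4 : (k : ℤ).toNat = k := by omega
    simp only [h1, h2, h3, h4, Finset.sum_range_succ]
    simp
  · obtain ⟨n, rfl⟩ : ∃ n : ℕ, k = -(n : ℤ) - 1 := ⟨(-k - 1).toNat, by omega⟩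
    have h1 : (-(n : ℤ) - 1 + 1).toNat = 0 := by omega
    have h2 : (-(-(n : ℤ) - 1 + 1)).toNat = n := by omega
    have h3 : (-(n : ℤ) - 1).toNat = 0 := by omega
    have h4 : (-(-(n : ℤ) - 1)).toNat = n + 1 := by omega
    simp only [h1, h2, h3, h4, Finset.sum_range_succ]
    simp

theorem IsCut.strictMono (hS : ∀ a, S a ≠ []) {ω : ℤ → 𝒜} {c : ℤ → ℤ} (hc : IsCut S ω c) :
    StrictMono c := by
  refine strictMono_int_of_lt_succ fun k => ?_
  rw [hc.2]
  have := List.length_pos_of_ne_nil (hS (ω k))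
  omega

theorem IsCut.le_of_nonneg (hS : ∀ a, S a ≠ []) {ω : ℤ → 𝒜} {c : ℤ → ℤ} (hc : IsCut S ω c)
    {k : ℤ} (hk : 0 ≤ k) : k ≤ c k := by
  lift k to ℕ using hk
  induction k with
  | zero => simp [hc.1]
  | succ k ih =>
    have := hc.strictMono hS (show (k : ℤ) < (k + 1 : ℕ) by omega)
    omega

theorem IsCut.le_of_nonpos (hS : ∀ a, S a ≠ []) {ω : ℤ → 𝒜} {c : ℤ → ℤ} (hc : IsCut S ω c)
    {k : ℤ} (hk : k ≤ 0) : c k ≤ k := by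
  obtain ⟨n, rfl⟩ : ∃ n : ℕ, k = -(n : ℤ) := ⟨(-k).toNat, by omega⟩
  clear hk
  induction n with
  | zero => simp [hc.1]
  | succ n ih =>
    have := hc.strictMono hS (show -((n + 1 : ℕ) : ℤ) < -(n : ℤ) by omega)
    omega

theorem IsCut.le_mul {L : ℕ} (hL : ∀ a, (S a).length ≤ L) {ω : ℤ → 𝒜} {c : ℤ → ℤ}
    (hc : IsCut S ω c) (n : ℕ) : c n ≤ n * L := by
  induction n with
  | zero => simp [hc.1]
  | succ n ih =>
    have := hc.2 n
    have := hL (ω n)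
    push_cast
    linarith

theorem IsCut.exists_block (hS : ∀ a, S a ≠ []) {ω : ℤ → 𝒜} {c : ℤ → ℤ} (hc : IsCut S ω c)
    (m : ℤ) : ∃ k, c k ≤ m ∧ m < c (k + 1) := by
  obtain ⟨k, hk, hmax⟩ := Int.exists_greatest_of_bdd (P := fun k => c k ≤ m)
    ⟨max m 0, fun z hz => by
      by_contra! h
      have := hc.le_of_nonneg hS (show 0 ≤ z by omega)
      omega⟩
    ⟨min m 0, (hc.le_of_nonpos hS (by omega)).trans (by omega)⟩
  refine ⟨k, hk, ?_⟩
  by_contra! h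
  have := hmax _ h
  omega

theorem IsCut.block_unique (hS : ∀ a, S a ≠ []) {ω : ℤ → 𝒜} {c : ℤ → ℤ} (hc : IsCut S ω c)
    {m k l : ℤ} (hk : c k ≤ m) (hk' : m < c (k + 1)) (hl : c l ≤ m) (hl' : m < c (l + 1)) :
    k = l := by
  have h1 := (hc.strictMono hS).lt_iff_lt.mp (hk.trans_lt hl')
  have h2 := (hc.strictMono hS).lt_iff_lt.mp (hl.trans_lt hk')
  omega

theorem IsCut.exists_hasBlocks (hS : ∀ a, S a ≠ []) {ω : ℤ → 𝒜} {c : ℤ → ℤ}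
    (hc : IsCut S ω c) : ∃ σ, HasBlocks S ω c σ := by
  have h : ∀ m : ℤ, ∃ b : ℬ, ∀ k : ℤ, ∀ j : Fin (S (ω k)).length, m = c k + j →
      b = (S (ω k)).get j := by
    intro m
    obtain ⟨k, hk, hk'⟩ := hc.exists_block hS m
    have h1 := hc.2 k
    refine ⟨(S (ω k)).get ⟨(m - c k).toNat, by omega⟩, fun l j hj => ?_⟩
    have h2 := hc.2 l
    have h3 := j.2
    obtain rfl := hc.block_unique hS hk hk' (l := l) (by omega) (by omega)
    congr 1
    ext
    simp only
    omega
  choose σ hσ using h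
  exact ⟨σ, fun k j => hσ _ k j rfl⟩

theorem IsCut.translate {ω : ℤ → 𝒜} {c : ℤ → ℤ} (hc : IsCut S ω c) (k : ℤ) :
    IsCut S (fun n => ω (n + k)) (fun n => c (n + k) - c k) := by
  refine ⟨by simp, fun n => ?_⟩
  have := hc.2 (n + k)
  rw [add_right_comm] at this
  simp only [this]
  ring

theorem HasBlocks.translate {ω : ℤ → 𝒜} {c : ℤ → ℤ} {σ : ℤ → ℬ} (h : HasBlocks S ω c σ)
    (k : ℤ) : HasBlocks S (fun n => ω (n + k)) (fun n => c (n + k) - c k)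
      (fun n => σ (n + c k)) := by
  intro n j
  rw [← h (n + k) j]
  simp only
  rw [sub_add_eq_add_sub, sub_add_cancel]

/-- Two cuts agree as long as the underlying sequences do. -/
theorem IsCut.congr {ω ρ : ℤ → 𝒜} {c d : ℤ → ℤ} (hc : IsCut S ω c) (hd : IsCut S ρ d) {M : ℕ}
    (h : ∀ i : ℤ, |i| ≤ (M : ℤ) → ω i = ρ i) (i : ℤ) (hi : |i| ≤ (M : ℤ)) : c i = d i := by
  induction i with
  | zero => rw [hc.1, hd.1]
  | succ n ih =>
    have hn : |(n : ℤ)| ≤ M := by rw [abs_le] at hi ⊢; omega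
    rw [hc.2, hd.2, ih hn, h _ hn]
  | pred n ih =>
    have hn : |(-(n : ℤ))| ≤ M := by rw [abs_le] at hi ⊢; omega
    have h1 := hc.2 (-n - 1)
    have h2 := hd.2 (-n - 1)
    rw [h _ hi] at h1
    have h3 := ih hn
    rw [sub_add_cancel] at h1 h2
    omega

/-- Substitution images agree on a window if the underlying sequences do. -/
theorem HasBlocks.congr (hS : ∀ a, S a ≠ []) {ω ρ : ℤ → 𝒜} {c d : ℤ → ℤ} {σ σ' : ℤ → ℬ}
    (hc : IsCut S ω c) (hσ : HasBlocks S ω c σ) (hd : IsCut S ρ d) (hσ' : HasBlocks S ρ d σ')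
    {M : ℕ} (h : ∀ i : ℤ, |i| ≤ (M : ℤ) → ω i = ρ i) (m : ℤ) (hm : |m| ≤ (M : ℤ)) :
    σ m = σ' m := by
  obtain ⟨k, hk, hk'⟩ := hc.exists_block hS m
  have hm' := abs_le.mp hm
  have hkM : |k| ≤ (M : ℤ) := by
    rw [abs_le]
    constructor
    · by_contra! hlt
      have := hc.le_of_nonpos hS (show k + 1 ≤ 0 by omega)
      omega
    · by_contra! hlt
      have := hc.le_of_nonneg hS (show 0 ≤ k by omega)
      omega
  have hcd := hc.congr hd h k hkM
  have hlen := hc.2 k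
  obtain ⟨j, hj⟩ : ∃ j : ℕ, m = c k + j := ⟨(m - c k).toNat, by omega⟩
  have h1 := hσ k ⟨j, by omega⟩
  have h2 := hσ' k ⟨j, by rw [← h k hkM]; omega⟩
  simp only at h1 h2
  rw [← hj] at h1
  rw [← hcd, ← hj] at h2
  rw [h1, h2]
  simp [h k hkM]

theorem HasBlocks.unique (hS : ∀ a, S a ≠ []) {ω : ℤ → 𝒜} {c d : ℤ → ℤ} {σ σ' : ℤ → ℬ}
    (hc : IsCut S ω c) (hσ : HasBlocks S ω c σ) (hd : IsCut S ω d) (hσ' : HasBlocks S ω d σ') :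
    σ = σ' :=
  funext fun m => HasBlocks.congr hS hc hσ hd hσ' (M := m.natAbs) (fun _ _ => rfl) m (by simp)

theorem SubstSubshift.translate_mem_s10 {Ω : Set (ℤ → 𝒜)} {τ : ℤ → ℬ}
    (hτ : τ ∈ SubstSubshift S Ω) (k : ℤ) : (fun n => τ (n + k)) ∈ SubstSubshift S Ω := by
  obtain ⟨ω, hω, σ, hσ, l, rfl⟩ := hτ
  refine ⟨ω, hω, σ, hσ, k + l, ?_⟩
  funext n
  simp only [add_assoc]

theorem HasBlocks.mem_substSubshift {Ω : Set (ℤ → 𝒜)} {ω : ℤ → 𝒜} (hω : ω ∈ Ω) {c : ℤ → ℤ}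
    {σ : ℤ → ℬ} (hc : IsCut S ω c) (hσ : HasBlocks S ω c σ) : σ ∈ SubstSubshift S Ω :=
  ⟨ω, hω, σ, ⟨c, hc.1, hc.2, hσ⟩, 0, by simp⟩

/-- Every point of `Ω(S)` is a translate, by a position inside the block at the origin, of the
image of some point of `Ω`. -/
theorem SubstSubshift.exists_block [TopologicalSpace 𝒜] {Ω : Set (ℤ → 𝒜)} (hΩ : IsSubshift Ω)
    (hS : ∀ a, S a ≠ []) {τ : ℤ → ℬ} (hτ : τ ∈ SubstSubshift S Ω) :
    ∃ ω ∈ Ω, ∃ c σ, IsCut S ω c ∧ HasBlocks S ω c σ ∧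
      ∃ k : ℕ, k < (S (ω 0)).length ∧ τ = (shift ℬ)^[k] σ := by
  obtain ⟨ω, hω, σ, ⟨c, h0, h1, hσ⟩, l, rfl⟩ := hτ
  have hc : IsCut S ω c := ⟨h0, h1⟩
  obtain ⟨k, hk, hk'⟩ := hc.exists_block hS l
  refine ⟨_, hΩ.translate_mem_s10 hω k, _, _, hc.translate k, HasBlocks.translate hσ k,
    (l - c k).toNat, ?_, ?_⟩
  · rw [hc.2] at hk'
    simp only [zero_add]
    omega
  · rw [shift_iterate_s10]
    funext n
    congr 1
    omega

end SubstImage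

section Induced

variable {𝒜 ℬ : Type*} {S : 𝒜 → List ℬ}

/-- The image of `ω` under the substitution `S`. -/
noncomputable def substImage (S : 𝒜 → List ℬ) (hS : ∀ a, S a ≠ []) (ω : ℤ → 𝒜) : ℤ → ℬ :=
  ((exists_isCut S ω).choose_spec.exists_hasBlocks hS).choose

theorem HasBlocks.eq_substImage (hS : ∀ a, S a ≠ []) {ω : ℤ → 𝒜} {c : ℤ → ℤ} {σ : ℤ → ℬ}
    (hc : IsCut S ω c) (hσ : HasBlocks S ω c σ) : σ = substImage S hS ω :=
  HasBlocks.unique hS hc hσ (exists_isCut S ω).choose_spec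
    ((exists_isCut S ω).choose_spec.exists_hasBlocks hS).choose_spec

/-- The function induced on `Ω` by a function `B` on `Ω(S)`: the product of `B` along the
block `S (ω 0)`. -/
noncomputable def inducedFn (S : 𝒜 → List ℬ) (hS : ∀ a, S a ≠ []) (B : (ℤ → ℬ) → SL2)
    (ω : ℤ → 𝒜) : SL2 :=
  cocycle B (S (ω 0)).length (substImage S hS ω)

theorem cocycle_inducedFn (hS : ∀ a, S a ≠ []) (B : (ℤ → ℬ) → SL2) {ω : ℤ → 𝒜} {c : ℤ → ℤ}
    {σ : ℤ → ℬ} (hc : IsCut S ω c) (hσ : HasBlocks S ω c σ) (n : ℕ) :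
    cocycle (inducedFn S hS B) n ω = cocycle B (c n).toNat σ := by
  induction n with
  | zero => simp [cocycle, hc.1]
  | succ n ih =>
    have hn : (0 : ℤ) ≤ c n := le_trans (by omega) (hc.le_of_nonneg hS (Int.natCast_nonneg n))
    have hlen : (c ((n + 1 : ℕ) : ℤ)).toNat = (S (ω n)).length + (c n).toNat := by
      have := hc.2 n
      push_cast
      omega
    rw [cocycle, ih, hlen, cocycle_add, inducedFn, shift_iterate_s10, shift_iterate_s10,
      ← HasBlocks.eq_substImage hS (hc.translate n) (hσ.translate n),
      Int.toNat_of_nonneg hn]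
    simp only [zero_add]

theorem locConstOn_inducedFn (hS : ∀ a, S a ≠ []) {L : ℕ} (hL : ∀ a, (S a).length ≤ L)
    {Ω : Set (ℤ → 𝒜)} {B : (ℤ → ℬ) → SL2} (hB : LocConstOn (SubstSubshift S Ω) B) :
    LocConstOn Ω (inducedFn S hS B) := by
  obtain ⟨N, hN⟩ := hB
  refine ⟨N + L, fun ω hω ρ hρ h => ?_⟩
  obtain ⟨c, hc⟩ := exists_isCut S ω
  obtain ⟨d, hd⟩ := exists_isCut S ρ
  obtain ⟨σ, hσ⟩ := hc.exists_hasBlocks hS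
  obtain ⟨σ', hσ'⟩ := hd.exists_hasBlocks hS
  rw [inducedFn, inducedFn, ← HasBlocks.eq_substImage hS hc hσ,
    ← HasBlocks.eq_substImage hS hd hσ', h 0 (by simp; omega)]
  refine cocycle_congr (fun _ => SubstSubshift.translate_mem_s10) hN (hσ.mem_substSubshift hω hc)
    (hσ'.mem_substSubshift hρ hd) _ fun i hi => HasBlocks.congr hS hc hσ hd hσ' h i ?_
  have := hL (ρ 0)
  push_cast at hi ⊢
  omega

theorem cocycle_diagExp_length {ω : ℤ → 𝒜} {c : ℤ → ℤ} (hc : IsCut S ω c) (n : ℕ) :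
    cocycle (fun ρ : ℤ → 𝒜 => diagExp (S (ρ 0)).length) n ω = diagExp (c n) := by
  induction n with
  | zero => simp [cocycle, hc.1, diagExp_zero]
  | succ n ih =>
    rw [cocycle, ih, ← diagExp_add, shift_iterate_s10]
    push_cast
    rw [hc.2, zero_add]
    push_cast
    rw [add_comm]

/-- Uniformity in terms of `ε` and `logNorm`. -/
theorem isUniformOn_iff {Ω : Set (ℤ → 𝒜)} {A : (ℤ → 𝒜) → SL2} :
    IsUniformOn Ω A ↔ ∃ Λ : ℝ, ∀ ε > 0, ∃ n₀ : ℕ, ∀ n ≥ n₀, ∀ ω ∈ Ω,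
      |logNorm (cocycle A n ω) - n * Λ| ≤ ε * n := by
  refine exists_congr fun Λ => ?_
  rw [Metric.tendstoUniformlyOn_iff]
  have key : ∀ (n : ℕ), 0 < n → ∀ x : ℝ,
      dist Λ ((n : ℝ)⁻¹ * x) = |x - n * Λ| / n := by
    intro n hn x
    have hn' : (0 : ℝ) < n := by exact_mod_cast hn
    rw [dist_comm, Real.dist_eq, ← abs_of_pos hn', ← abs_div, abs_of_pos hn']
    congr 1
    field_simp
  constructor
  · intro h ε hε
    obtain ⟨n₀, hn₀⟩ := eventually_atTop.mp (h ε hε)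
    refine ⟨n₀ + 1, fun n hn ω hω => ?_⟩
    have h1 := hn₀ n (by omega) ω hω
    have hn' : (0 : ℝ) < n := by exact_mod_cast (by omega : 0 < n)
    rw [key n (by omega), div_lt_iff₀ hn'] at h1
    exact h1.le
  · intro h ε hε
    obtain ⟨n₀, hn₀⟩ := h (ε / 2) (by positivity)
    refine eventually_atTop.mpr ⟨n₀ + 1, fun n hn ω hω => ?_⟩
    have h1 := hn₀ n (by omega) ω hω
    have hn' : (0 : ℝ) < n := by exact_mod_cast (by omega : 0 < n)
    rw [key n (by omega), div_lt_iff₀ hn']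
    exact h1.trans_lt (by nlinarith)

/-- The norm of the cocycle of `B` at time `m` is comparable to that of the induced cocycle at
the time `n` for which the first `n` blocks cover about `m` positions. -/
theorem exists_abs_logNorm_cocycle_sub_le [TopologicalSpace 𝒜] {Ω : Set (ℤ → 𝒜)}
    (hΩ : IsSubshift Ω) (hS : ∀ a, S a ≠ []) {L : ℕ} (hL : ∀ a, (S a).length ≤ L)
    {B : (ℤ → ℬ) → SL2} {K : ℝ}
    (hK : ∀ τ ∈ SubstSubshift S Ω, ∀ j ≤ L, logNorm (cocycle B j τ) ≤ K)
    {τ : ℤ → ℬ} (hτ : τ ∈ SubstSubshift S Ω) (m : ℕ) :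
    ∃ ω ∈ Ω, ∃ c, IsCut S ω c ∧ ∃ n : ℕ, |c n - m| ≤ (L : ℤ) ∧
      |logNorm (cocycle B m τ) - logNorm (cocycle (inducedFn S hS B) n ω)| ≤ K + K := by
  obtain ⟨ω, hω, c, σ, hc, hσ, k, hk, rfl⟩ := SubstSubshift.exists_block hΩ hS hτ
  have hσmem := hσ.mem_substSubshift hω hc
  obtain ⟨n, hn, hn'⟩ := hc.exists_block hS (m + k : ℕ)
  have hn0 : 0 ≤ n := by
    by_contra! h
    have := hc.le_of_nonpos hS (show n + 1 ≤ 0 by omega)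
    omega
  have hcn := hc.le_of_nonneg hS hn0
  have hlen := hc.2 n
  have h1 := hL (ω n)
  have h2 := hL (ω 0)
  lift n to ℕ using hn0
  refine ⟨ω, hω, c, hc, n, by rw [abs_le]; omega, ?_⟩
  obtain ⟨p, hp⟩ : ∃ p : ℕ, c n = p := ⟨(c n).toNat, by omega⟩
  obtain ⟨r, hr⟩ : ∃ r : ℕ, m + k = r + p := ⟨m + k - p, by omega⟩
  have heq := cocycle_add B m k σ
  rw [hr, cocycle_add] at heq
  refine (abs_logNorm_sub_le_of_mul_eq (u := cocycle B k σ)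
    (v := cocycle B r ((shift ℬ)^[p] σ)) ?_).trans (add_le_add (hK _ hσmem _ (by omega))
      (hK _ ?_ _ (by omega)))
  · rw [← heq, cocycle_inducedFn hS B hc hσ, hp, Int.toNat_natCast]
  · rw [shift_iterate_s10]
    exact SubstSubshift.translate_mem_s10 hσmem p

end Induced

/-- property (P) is stable under substitutions. -/
theorem stmt10 {𝒜 ℬ : Type*} [Fintype 𝒜] [TopologicalSpace 𝒜] [DiscreteTopology 𝒜]
    [MeasurableSpace 𝒜] [Fintype ℬ] [TopologicalSpace ℬ] [DiscreteTopology ℬ]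
    (Ω : Set (ℤ → 𝒜)) (hmin : IsMinimalSubshift Ω) (hue : UniquelyErgodicSubshift Ω)
    (hP : PropP Ω) (S : 𝒜 → List ℬ) (hS : ∀ a, S a ≠ []) :
    PropP (SubstSubshift S Ω) := by
  intro B hB
  have hΩ := hmin.1
  obtain ⟨L, hL⟩ : ∃ L : ℕ, ∀ a, (S a).length ≤ L :=
    ⟨Finset.univ.sup fun a => (S a).length, fun a =>
      Finset.le_sup (f := fun a => (S a).length) (Finset.mem_univ a)⟩
  obtain ⟨K, hK0, hK⟩ :=
    exists_logNorm_cocycle_le (fun _ => SubstSubshift.translate_mem_s10) hB L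
  obtain ⟨Λ, hΛ⟩ := isUniformOn_iff.mp (hP _ (locConstOn_inducedFn hS hL hB))
  have hloc : LocConstOn Ω fun ρ : ℤ → 𝒜 => diagExp (S (ρ 0)).length :=
    ⟨0, fun ω _ ρ _ h => by simp only [h 0 (by simp)]⟩
  obtain ⟨l, hl⟩ := isUniformOn_iff.mp (hP _ hloc)
  -- `l` is the mean block length
  have hlen : ∀ ε > 0, ∃ n₀ : ℕ, ∀ n ≥ n₀, ∀ ω ∈ Ω, ∀ c, IsCut S ω c →
      |(c n : ℝ) - n * l| ≤ ε * n + 1 := by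
    intro ε hε
    obtain ⟨n₀, hn₀⟩ := hl ε hε
    refine ⟨n₀, fun n hn ω hω c hc => ?_⟩
    have h1 := hn₀ n hn ω hω
    have h0 : (0 : ℤ) ≤ c n := le_trans (by omega) (hc.le_of_nonneg hS (Int.natCast_nonneg n))
    have h2 := abs_logNorm_diagExp_sub_le (t := (c n : ℝ)) (by exact_mod_cast h0)
    rw [cocycle_diagExp_length hc] at h1
    rw [abs_le] at h1 h2 ⊢
    constructor <;> linarith
  rcases Ω.eq_empty_or_nonempty with rfl | ⟨ω₀, hω₀⟩
  · refine isUniformOn_iff.mpr ⟨0, fun ε hε => ⟨0, fun n hn τ hτ => ?_⟩⟩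
    obtain ⟨ω, hω, -⟩ := hτ
    exact hω.elim
  have hl0 : 0 < l := by
    obtain ⟨c, hc⟩ := exists_isCut S ω₀
    obtain ⟨n₀, hn₀⟩ := hlen (1 / 4) (by norm_num)
    have h1 := (abs_le.mp (hn₀ (n₀ + 4) (by omega) ω₀ hω₀ c hc)).2
    have h2 : ((n₀ + 4 : ℕ) : ℝ) ≤ (c (n₀ + 4 : ℕ) : ℝ) := by
      exact_mod_cast hc.le_of_nonneg hS (Int.natCast_nonneg (n₀ + 4))
    have h3 : (4 : ℝ) ≤ ((n₀ + 4 : ℕ) : ℝ) := by push_cast; linarith [n₀.cast_nonneg (α := ℝ)]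
    by_contra! h
    nlinarith
  refine isUniformOn_iff.mpr ⟨Λ / l, fun δ hδ => ?_⟩
  set q : ℝ := |Λ| / l with hq
  have hq0 : 0 ≤ q := by positivity
  set ε : ℝ := δ / (4 * (1 + q)) with hε
  have hε0 : 0 < ε := by positivity
  obtain ⟨n₁, hn₁⟩ := hΛ ε hε0
  obtain ⟨n₂, hn₂⟩ := hlen ε hε0
  obtain ⟨m₀, hm₀⟩ := exists_nat_ge ((K + K + q * (1 + L)) / (δ / 2))
  refine ⟨m₀ + (L + (n₁ + n₂) * L), fun m hm τ hτ => ?_⟩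
  obtain ⟨ω, hω, c, hc, n, hcn, hcomp⟩ :=
    exists_abs_logNorm_cocycle_sub_le hΩ hS hL hK hτ m
  have hcn' := abs_le.mp hcn
  have hLpos : 0 < L := (List.length_pos_of_ne_nil (hS (ω 0))).trans_le (hL _)
  have hnle : n ≤ 2 * m := by
    have := hc.le_of_nonneg hS (Int.natCast_nonneg n)
    omega
  have hnge : n₁ + n₂ ≤ n := by
    have h1 := hc.le_mul hL n
    have h2 : (n₁ + n₂) * L ≤ n * L := by
      zify at hm ⊢
      linarith
    exact Nat.le_of_mul_le_mul_right h2 hLpos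
  have e1 := hn₁ n (by omega) ω hω
  have e2 := hn₂ n (by omega) ω hω c hc
  have e3 : |(c n : ℝ) - m| ≤ L := by exact_mod_cast hcn
  have e4 : |(n : ℝ) * Λ - m * (Λ / l)| ≤ q * (ε * n + 1 + L) := by
    have : (n : ℝ) * Λ - m * (Λ / l) = Λ / l * (((c n : ℝ) - m) - (c n - n * l)) := by
      field_simp
      ring
    rw [this, abs_mul, abs_div, abs_of_pos hl0, ← hq]
    gcongr
    exact (abs_sub _ _).trans (by linarith)
  have e5 : K + K + q * (1 + L) ≤ δ / 2 * m := by
    rw [div_le_iff₀ (by positivity)] at hm₀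
    have : (m₀ : ℝ) ≤ m := by exact_mod_cast (by omega : m₀ ≤ m)
    nlinarith
  have e6 : ε * (1 + q) * n ≤ δ / 2 * m := by
    have h1 : ε * (1 + q) = δ / 4 := by rw [hε]; field_simp
    have h2 : (n : ℝ) ≤ 2 * m := by exact_mod_cast hnle
    rw [h1]
    nlinarith
  rw [abs_le] at hcomp e1 e4 ⊢
  constructor <;> nlinarith
end

section
/- Let α ∈ (0,1) be irrational. Then for Lebesgue-almost every β ∈ (0,1), the circle map subshift Ω_{α,β} satisfies Boshernitzan's condition (B). -/
open Filter MeasureTheory Set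

/-- Every irrational number has arbitrarily large `n` such that no smaller positive multiple of it
is within `1 / (2 * n)` of an integer. -/
theorem exists_le_abs_mul_sub_int {α : ℝ} (hirr : Irrational α) (N : ℕ) :
    ∃ n : ℕ, N ≤ n ∧ 0 < n ∧ ∀ k : ℕ, 0 < k → k < n → ∀ m : ℤ,
      1 / (2 * n : ℝ) ≤ |k * α - m| := by
  set d : ℕ → ℝ := fun k => |k * α - round (k * α)| with hd
  have d_le (k : ℕ) (m : ℤ) : d k ≤ |k * α - m| := round_le _ m
  have d_pos (k : ℕ) (hk : 0 < k) : 0 < d k := by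
    have h := (hirr.natCast_mul hk.ne').ne_int (round (k * α))
    exact abs_pos.2 (sub_ne_zero.2 h)
  obtain ⟨q, hq, hqmin⟩ := (Finset.Icc 1 (max N 1)).exists_min_image d ⟨1, by simp⟩
  have hq0 : 0 < q := (Finset.mem_Icc.1 hq).1
  have hex : ∃ k : ℕ, 0 < k ∧ d k < d q := by
    obtain ⟨n, hn⟩ := exists_nat_one_div_lt (d_pos q hq0)
    obtain ⟨k, hk, -, hkn⟩ := Real.exists_nat_abs_mul_sub_round_le α n.succ_pos
    refine ⟨k, hk, hkn.trans_lt (lt_of_le_of_lt ?_ hn)⟩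
    push_cast
    gcongr
    linarith
  classical
  obtain ⟨hn0, hnq⟩ := Nat.find_spec hex
  have hmin (k : ℕ) (hk : 0 < k) (hkn : k < Nat.find hex) : d q ≤ d k := by
    by_contra! h
    exact Nat.find_min hex hkn ⟨hk, h⟩
  generalize Nat.find hex = n at hn0 hnq hmin
  have hNn : max N 1 < n := by
    by_contra! h
    exact (hqmin n (Finset.mem_Icc.2 ⟨hn0, h⟩)).not_gt hnq
  have hqn : q < n := (Finset.mem_Icc.1 hq).2.trans_lt hNn
  refine ⟨n, (le_max_left _ _).trans hNn.le, hn0, fun k hk hkn m => ?_⟩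
  refine le_trans ?_ ((hmin k hk hkn).trans (d_le k m))
  by_contra! hlt
  have hn' : (0 : ℝ) < n := by exact_mod_cast hn0
  have hq' : (0 : ℝ) < q := by exact_mod_cast hq0
  have hqn' : (q : ℝ) < n := by exact_mod_cast hqn
  rw [lt_div_iff₀ (by positivity)] at hlt
  set p := round (q * α)
  set p' := round (n * α)
  have hdet : (q : ℝ) * (n * α - p') - n * (q * α - p) = ((n * p - q * p' : ℤ) : ℝ) := by
    push_cast; ring
  have hsmall : |((n * p - q * p' : ℤ) : ℝ)| < 1 := by
    rw [← hdet]
    calc |(q : ℝ) * (n * α - p') - n * (q * α - p)|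
        ≤ |(q : ℝ) * (n * α - p')| + |n * (q * α - p)| := abs_sub _ _
      _ = q * d n + n * d q := by simp [hd, abs_mul, p, p']
      _ ≤ n * d q + n * d q := by gcongr
      _ < 1 := by linarith
  have hzero : (n * p - q * p' : ℤ) = 0 := Int.abs_lt_one_iff.1 (by exact_mod_cast hsmall)
  rw [hzero, Int.cast_zero, sub_eq_zero] at hdet
  have habs : (q : ℝ) * d n = n * d q := by
    simpa [hd, abs_mul, p, p'] using congrArg abs hdet
  have : (q : ℝ) * d n < n * d q := by
    have := d_pos n hn0
    nlinarith
  exact this.ne habs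

/-- The indicators of `[0, β)` modulo one at `x < y` agree unless an endpoint is crossed. -/
theorem exists_int_mem_Ioc_of_fract_lt_iff_ne {β x y : ℝ} (hxy : x ≤ y)
    (h : ¬ (Int.fract x < β ↔ Int.fract y < β)) :
    ∃ e : ℝ, (e = 0 ∨ e = β) ∧ ∃ m : ℤ, e + m ∈ Ioc x y := by
  by_contra! hcon
  have h0 := hcon 0 (.inl rfl) ⌊y⌋
  have h1 := hcon β (.inr rfl) ⌊y⌋
  simp only [mem_Ioc, not_and_or, not_lt, not_le, zero_add] at h0 h1
  have hfl : ⌊x⌋ = ⌊y⌋ := by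
    refine le_antisymm (Int.floor_mono hxy) (Int.le_floor.2 ?_)
    rcases h0 with h0 | h0
    · exact h0
    · exact absurd (Int.floor_le y) h0.not_ge
  apply h
  unfold Int.fract
  rw [hfl]
  constructor <;> intro h <;> rcases h1 with h1 | h1 <;> linarith

theorem circleSeq_periodic (α β : ℝ) : Function.Periodic (circleSeq α β) 1 := by
  intro θ
  funext n
  simp only [circleSeq, ← add_assoc, Int.fract_add_one]

theorem circleSeq_add (α β θ : ℝ) (k n : ℤ) :
    circleSeq α β (θ + k * α) n = circleSeq α β θ (n + k) := by
  simp only [circleSeq]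
  push_cast
  ring_nf

theorem circleSeq_mem_circleSubshift (α β θ : ℝ) : circleSeq α β θ ∈ circleSubshift α β := by
  refine subset_closure ⟨Int.fract θ, Int.fract_nonneg _, Int.fract_lt_one _, ?_⟩
  have := (circleSeq_periodic α β).sub_int_mul_eq (x := θ) ⌊θ⌋
  rw [← this, mul_one]
  rfl

theorem measurable_circleSeq (α β : ℝ) : Measurable (circleSeq α β) := by
  refine measurable_pi_lambda _ fun n => ?_
  refine Measurable.ite ?_ measurable_const measurable_const
  exact measurableSet_lt (by fun_prop) measurable_const

theorem isOpen_setOf_occursAt {𝒜 : Type*} [TopologicalSpace 𝒜] [DiscreteTopology 𝒜]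
    (w : List 𝒜) (k : ℤ) : IsOpen {ω : ℤ → 𝒜 | OccursAt ω w k} := by
  simp only [OccursAt, ofPred_forall]
  exact isOpen_iInter_of_finite fun i =>
    (isOpen_discrete {w.get i}).preimage (f := fun ω : ℤ → 𝒜 => ω (k + (i : ℤ)))
      (continuous_apply _)

theorem IsWordOf.exists_circleSeq {α β : ℝ} {w : List Bool}
    (hw : IsWordOf (circleSubshift α β) w) : ∃ θ : ℝ, OccursAt (circleSeq α β θ) w 1 := by
  obtain ⟨ω, hω, k, hk⟩ := hw
  obtain ⟨_, h, θ, -, -, rfl⟩ := mem_closure_iff.1 hω _ (isOpen_setOf_occursAt w k) hk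
  refine ⟨θ + (k - 1 : ℤ) * α, fun i => ?_⟩
  rw [circleSeq_add, ← h i]
  congr 1
  ring

instance : IsProbabilityMeasure (volume : Measure UnitAddCircle) := ⟨UnitAddCircle.measure_univ⟩

/-- The factor map from the circle to sequences. -/
noncomputable def circleCoding (α β : ℝ) : UnitAddCircle → ℤ → Bool := (circleSeq_periodic α β).lift

theorem circleCoding_coe (α β θ : ℝ) : circleCoding α β (θ : UnitAddCircle) = circleSeq α β θ :=
  rfl

theorem measurable_circleCoding (α β : ℝ) : Measurable (circleCoding α β) := by
  have h : circleCoding α β =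
      circleSeq α β ∘ Subtype.val ∘ AddCircle.measurableEquivIco (1 : ℝ) 0 := by
    funext x
    obtain ⟨y, rfl⟩ := (AddCircle.measurableEquivIco (1 : ℝ) 0).symm.surjective x
    simp only [Function.comp_apply, MeasurableEquiv.apply_symm_apply]
    rfl
  rw [h]
  exact (measurable_circleSeq α β).comp
    (measurable_subtype_coe.comp (AddCircle.measurableEquivIco (1 : ℝ) 0).measurable)

theorem ergodic_shift_map_circleCoding {α : ℝ} (hirr : Irrational α) (β : ℝ) :
    Ergodic (shift Bool) ((volume : Measure UnitAddCircle).map (circleCoding α β)) := by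
  have hmp : MeasurePreserving (circleCoding α β) (volume : Measure UnitAddCircle)
      ((volume : Measure UnitAddCircle).map (circleCoding α β)) :=
    (measurable_circleCoding α β).measurePreserving _
  refine hmp.ergodic_of_ergodic_semiconj (f := (· + (α : UnitAddCircle))) ?_ ?_ ?_
  · rw [AddCircle.ergodic_add_right, addOrderOf_eq_zero_iff,
      AddCircle.not_isOfFinAddOrder_iff_forall_rat_ne_div]
    intro q hq
    exact hirr ⟨q, by simpa using hq⟩
  · exact measurable_pi_lambda _ fun n => measurable_pi_apply (n + 1)
  · intro x
    induction x using QuotientAddGroup.induction_on with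
    | H θ =>
      funext n
      simp only [shift]
      rw [← QuotientAddGroup.mk_add, circleCoding_coe, circleCoding_coe]
      simpa using circleSeq_add α β θ 1 n

/-- If the discontinuities of the coding of length `n` are `2 * g`-separated on the circle, then
every word of length `n` is coded by an interval of length at least `g`. -/
theorem exists_Ioo_subset_occursAt {α β g θ : ℝ} {w : List Bool} (hg : 0 < g) (hg1 : 2 * g ≤ 1)
    (hα : ∀ k : ℕ, 0 < k → k < w.length → ∀ m : ℤ, 2 * g ≤ |k * α - m|)
    (hβ : ∀ k : ℤ, |k| < w.length → ∀ m : ℤ, 2 * g ≤ |β + k * α - m|)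
    (hθ : OccursAt (circleSeq α β θ) w 1) :
    ∃ a : ℝ, ∀ t ∈ Ioo a (a + g), OccursAt (circleSeq α β t) w 1 := by
  have key (s t : ℝ) (hst : s ≤ t)
      (h : ¬ ∀ i : Fin w.length, circleSeq α β s (1 + i) = circleSeq α β t (1 + i)) :
      ∃ e : ℝ, (e = 0 ∨ e = β) ∧ ∃ m : ℤ, ∃ i : Fin w.length,
        e + m - ((i : ℕ) + 1) * α ∈ Ioc s t := by
    push Not at h
    obtain ⟨i, hi⟩ := h
    have hi' : ¬ (Int.fract (((1 + (i : ℕ) : ℤ) : ℝ) * α + s) < β ↔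
        Int.fract (((1 + (i : ℕ) : ℤ) : ℝ) * α + t) < β) := by
      intro h
      apply hi
      simp only [circleSeq, h]
    obtain ⟨e, he, m, h1, h2⟩ := exists_int_mem_Ioc_of_fract_lt_iff_ne (by linarith) hi'
    push_cast at h1 h2
    exact ⟨e, he, m, i, by linarith, by linarith⟩
  by_cases hr : ∀ t ∈ Ioo θ (θ + g), OccursAt (circleSeq α β t) w 1
  · exact ⟨θ, hr⟩
  by_cases hl : ∀ t ∈ Ioo (θ - g) (θ - g + g), OccursAt (circleSeq α β t) w 1
  · exact ⟨θ - g, hl⟩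
  exfalso
  push Not at hr hl
  obtain ⟨t, ht, htw⟩ := hr
  obtain ⟨s, hs, hsw⟩ := hl
  rw [sub_add_cancel] at hs
  obtain ⟨e, he, m, i, h1, h2⟩ := key θ t ht.1.le fun h => htw fun i => (h i).symm.trans (hθ i)
  obtain ⟨e', he', m', i', h1', h2'⟩ := key s θ hs.2.le fun h => hsw fun i => (h i).trans (hθ i)
  have hD0 : 0 < (e - e') + (m - m') - ((i : ℕ) - (i' : ℕ) : ℝ) * α := by nlinarith
  have hD1 : (e - e') + (m - m') - ((i : ℕ) - (i' : ℕ) : ℝ) * α < 2 * g := by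
    nlinarith [ht.2, hs.1]
  have hi := i.2
  have hi' := i'.2
  have same (hee : e = e') : False := by
    rw [hee, sub_self, zero_add] at hD0 hD1
    rcases lt_trichotomy (i : ℕ) i' with h | h | h
    · refine (hα (i' - i : ℕ) (by omega) (by omega) (m' - m)).not_gt ?_
      push_cast [h.le]
      rw [abs_lt]
      constructor <;> linarith
    · rw [h, sub_self, zero_mul, sub_zero] at hD0 hD1
      have h0 : 0 < m - m' := by exact_mod_cast hD0
      have h1 : m - m' < 1 := by exact_mod_cast hD1.trans_le hg1
      omega
    · refine (hα (i - i' : ℕ) (by omega) (by omega) (m - m')).not_gt ?_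
      push_cast [h.le]
      rw [abs_lt]
      constructor <;> linarith
  rcases he with he | he <;> rcases he' with he' | he'
  · exact same (he.trans he'.symm)
  · subst he he'
    refine (hβ (i - i') (by rw [abs_lt]; omega) (m - m')).not_gt ?_
    push_cast
    rw [abs_lt]
    constructor <;> linarith
  · subst he he'
    refine (hβ (i' - i) (by rw [abs_lt]; omega) (m' - m)).not_gt ?_
    push_cast
    rw [abs_lt]
    constructor <;> linarith
  · exact same (he.trans he'.symm)

theorem le_map_circleCoding_Vset {α β g a : ℝ} {w : List Bool} (hg : 0 < g) (hg1 : 2 * g ≤ 1)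
    (ha : ∀ t ∈ Ioo a (a + g), OccursAt (circleSeq α β t) w 1) :
    ENNReal.ofReal g ≤ (volume : Measure UnitAddCircle).map (circleCoding α β)
      (Vset (circleSubshift α β) w) := by
  rw [← (UnitAddCircle.measurePreserving_mk a).map_eq,
    Measure.map_map (measurable_circleCoding α β) AddCircle.measurable_mk']
  refine le_trans ?_ (Measure.le_map_apply
    ((measurable_circleCoding α β).comp AddCircle.measurable_mk').aemeasurable _)
  calc ENNReal.ofReal g = volume.restrict (Ioc a (a + 1)) (Ioo a (a + g)) := by
        have hsub : Ioo a (a + g) ⊆ Ioc a (a + 1) := fun t ht => ⟨ht.1, by linarith [ht.2]⟩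
        rw [Measure.restrict_apply measurableSet_Ioo, inter_eq_left.2 hsub, Real.volume_Ioo,
          add_sub_cancel_left]
    _ ≤ volume.restrict (Ioc a (a + 1)) (circleCoding α β ∘ ((↑) : ℝ → UnitAddCircle) ⁻¹'
          Vset (circleSubshift α β) w) :=
        measure_mono fun t ht =>
          show circleSeq α β t ∈ Vset _ w from ⟨circleSeq_mem_circleSubshift α β t, ha t ht⟩

/-- For almost every point of the circle, the distance to the `n`-th orbit segment of a rotation
is at least of order `1 / n` for infinitely many `n` along any prescribed sequence. -/
theorem ae_exists_frequently_le_norm_add_zsmul (a : UnitAddCircle) {f : ℕ → ℕ}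
    (hf : ∀ i, 0 < f i) :
    ∀ᵐ x : UnitAddCircle, ∃ ε : ℝ, 0 < ε ∧ ε ≤ 1 / 2 ∧ ∃ᶠ i in atTop,
      ∀ k : ℤ, |k| < f i → ε / f i ≤ ‖x + k • a‖ := by
  set B : ℝ → ℕ → Set UnitAddCircle :=
    fun ε i => {x | ¬ ∀ k : ℤ, |k| < f i → ε / f i ≤ ‖x + k • a‖} with hB
  have hBi (ε : ℝ) (hε : 0 < ε) (i : ℕ) : volume (B ε i) ≤ ENNReal.ofReal (4 * ε) := by
    have hfi : (0 : ℝ) < f i := by exact_mod_cast hf i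
    have hsub : B ε i ⊆ ⋃ k ∈ Finset.Ioo (-(f i : ℤ)) (f i),
        Metric.closedBall (-(k • a)) (ε / f i) := by
      intro x hx
      simp only [hB, mem_ofPred_eq] at hx
      push Not at hx
      obtain ⟨k, hk, hkx⟩ := hx
      refine mem_biUnion (Finset.mem_coe.2 (Finset.mem_Ioo.2 (abs_lt.1 hk))) ?_
      rw [Metric.mem_closedBall, dist_eq_norm, sub_neg_eq_add]
      exact hkx.le
    calc volume (B ε i) ≤ ∑ k ∈ Finset.Ioo (-(f i : ℤ)) (f i),
          volume (Metric.closedBall (-(k • a)) (ε / f i)) :=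
          (measure_mono hsub).trans (measure_biUnion_finset_le _ _)
      _ ≤ ∑ k ∈ Finset.Ioo (-(f i : ℤ)) (f i), ENNReal.ofReal (2 * (ε / f i)) := by
          refine Finset.sum_le_sum fun k _ => ?_
          rw [AddCircle.volume_closedBall]
          exact ENNReal.ofReal_le_ofReal (min_le_right _ _)
      _ ≤ ((2 * f i : ℕ) : ENNReal) * ENNReal.ofReal (2 * (ε / f i)) := by
          rw [Finset.sum_const, nsmul_eq_mul, Int.card_Ioo]
          gcongr
          omega
      _ = ENNReal.ofReal (4 * ε) := by
          rw [← ENNReal.ofReal_natCast, ← ENNReal.ofReal_mul (by positivity)]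
          congr 1
          push_cast
          field_simp
          norm_num
  have hev (ε : ℝ) (hε : 0 < ε) :
      volume {x | ∀ᶠ i in atTop, x ∈ B ε i} ≤ ENNReal.ofReal (4 * ε) := by
    have hset : {x | ∀ᶠ i in atTop, x ∈ B ε i} = ⋃ M : ℕ, ⋂ i ∈ Ici M, B ε i := by
      ext x
      simp [eventually_atTop]
    have hmono : Monotone fun M : ℕ => ⋂ i ∈ Ici M, B ε i :=
      fun M M' h => biInter_subset_biInter_left (Ici_subset_Ici.2 h)
    rw [hset, hmono.measure_iUnion]
    exact iSup_le fun M => (measure_mono (biInter_subset_of_mem self_mem_Ici)).trans (hBi ε hε M)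
  rw [ae_iff]
  have hbound (ε : ℝ) (hε : 0 < ε) (hε2 : ε ≤ 1 / 2) :
      volume {x : UnitAddCircle | ¬ ∃ ε : ℝ, 0 < ε ∧ ε ≤ 1 / 2 ∧ ∃ᶠ i in atTop,
        ∀ k : ℤ, |k| < f i → ε / f i ≤ ‖x + k • a‖} ≤ ENNReal.ofReal (4 * ε) := by
    refine (measure_mono fun x hx => ?_).trans (hev ε hε)
    by_contra h
    exact hx ⟨ε, hε, hε2, fun h' => h h'⟩
  refine le_antisymm (ENNReal.le_of_forall_pos_le_add fun r hr _ => ?_) zero_le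
  have hr' : (0 : ℝ) < r := by exact_mod_cast hr
  refine (hbound (min (1 / 2) (r / 4)) (by positivity) (min_le_left _ _)).trans ?_
  rw [zero_add]
  refine ENNReal.ofReal_le_of_le_toReal ?_
  rw [ENNReal.coe_toReal]
  linarith [min_le_right (1 / 2 : ℝ) (r / 4)]

/-- for irrational `α` and almost every `β`, the circle map subshift
`Ω_{α,β}` satisfies (B). -/
theorem stmt16 (α : ℝ) (hα : α ∈ Set.Ioo (0 : ℝ) 1) (hirr : Irrational α) :
    ∀ᵐ β ∂(volume : Measure ℝ), β ∈ Set.Ioo (0 : ℝ) 1 →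
      CondB (circleSubshift α β) := by
  choose f hfN hf0 hf using exists_le_abs_mul_sub_int hirr
  have hae := (UnitAddCircle.measurePreserving_mk 0).quasiMeasurePreserving.ae
    (ae_exists_frequently_le_norm_add_zsmul (α : UnitAddCircle) hf0)
  rw [ae_restrict_iff' measurableSet_Ioc] at hae
  filter_upwards [hae] with β hβ hβ01
  obtain ⟨ε, hε, hε2, hfreq⟩ := hβ ⟨hβ01.1, by linarith [hβ01.2]⟩
  obtain ⟨φ, hφ, hφε⟩ := extraction_of_frequently_atTop hfreq
  have hmeas := measurable_circleCoding α β
  refine ⟨(volume : Measure UnitAddCircle).map (circleCoding α β),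
    Measure.isProbabilityMeasure_map hmeas.aemeasurable, ?_,
    ergodic_shift_map_circleCoding hirr β, ε / 2, by positivity, fun i => f (φ i),
    tendsto_atTop_mono (fun i => (hφ.id_le i).trans (hfN (φ i))) tendsto_id, fun i w hw hwl => ?_⟩
  · rw [Measure.map_apply hmeas 
      (show IsClosed (circleSubshift α β) from isClosed_closure).measurableSet.compl]
    convert measure_empty (μ := (volume : Measure UnitAddCircle))
    refine eq_empty_of_forall_notMem fun x hx => ?_
    induction x using QuotientAddGroup.induction_on with
    | H θ => exact hx (circleSeq_mem_circleSubshift α β θ)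
  · replace hwl : w.length = f (φ i) := hwl
    have hn : 0 < w.length := hwl ▸ hf0 (φ i)
    have hn' : (1 : ℝ) ≤ w.length := by exact_mod_cast hn
    set g : ℝ := ε / 2 / w.length with hg
    have hg0 : 0 < g := by positivity
    have hg2 : 2 * g = ε / w.length := by rw [hg]; ring
    have hg1 : 2 * g ≤ 1 := by
      rw [hg2, div_le_one (by positivity)]
      linarith
    obtain ⟨θ, hθ⟩ := hw.exists_circleSeq
    have hαg (k : ℕ) (hk : 0 < k) (hkn : k < w.length) (m : ℤ) : 2 * g ≤ |k * α - m| := by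
      refine le_trans ?_ (hf (φ i) k hk (hwl ▸ hkn) m)
      rw [hg2, ← hwl, div_le_div_iff₀ (by positivity) (by positivity)]
      nlinarith
    have hβg (k : ℤ) (hk : |k| < w.length) (m : ℤ) : 2 * g ≤ |β + k * α - m| := by
      have h := hφε i k (hwl ▸ hk)
      rw [← AddCircle.coe_zsmul, ← AddCircle.coe_add, UnitAddCircle.norm_eq, zsmul_eq_mul,
        ← hwl] at h
      rw [hg2]
      exact h.trans (round_le _ m)
    obtain ⟨a, ha⟩ := exists_Ioo_subset_occursAt hg0 hg1 hαg hβg hθ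
    have hle := (ENNReal.ofReal_le_iff_le_toReal (measure_ne_top _ _)).1
      (le_map_circleCoding_Vset hg0 hg1 ha)
    calc ε / 2 = w.length * g := by rw [hg]; field_simp
      _ ≤ _ := by gcongr
end
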